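/- arXiv:2512.13967 — 2 statements merged into one kernel-verified Lean document; each statement's English description precedes it below -/
import Mathlib

section
/- The growth of R∞ satisfies 𝔤_n(R∞) ∈ Θ(λ₁ⁿ): there exist constants c, C > 0 such that c·λ₁ⁿ ≤ 𝔤_n(R∞) ≤ C·λ₁ⁿ for all sufficiently large n, where λ₁ ≈ 2.50506841362147 is the largest real root of the polynomial X⁴ − 3X³ + X² + X − 1. -/
abbrev F2 := FreeGroup (Fin 2)

def CyclicallyReduced2 (w : F2) : Prop :=
  ∀ x ∈ w.toWord.head?, ∀ y ∈ w.toWord.getLast?, x ≠ (y.1, !y.2)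

/-- `u` occurs as a cyclic subword of `w`. -/
def CyclicSubword2 (u : List (Fin 2 × Bool)) (w : F2) : Prop :=
  u.length ≤ w.toWord.length ∧ u <:+: (w.toWord ++ w.toWord)

def lA : Fin 2 × Bool := (0, true)
def lAi : Fin 2 × Bool := (0, false)
def lB : Fin 2 × Bool := (1, true)
def lBi : Fin 2 × Bool := (1, false)

/-- The set `R∞`. -/
def Rinf : Set F2 :=
  {w | CyclicallyReduced2 w ∧ ¬ CyclicSubword2 [lAi, lBi] w ∧ ¬ CyclicSubword2 [lBi, lAi] w ∧
    ∀ k : ℕ, ¬ CyclicSubword2 ([lBi] ++ List.replicate k lA ++ [lBi]) w}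

noncomputable def growth2 (S : Set F2) (n : ℕ) : ℕ :=
  Nat.card {w : F2 // w ∈ S ∧ FreeGroup.norm w = n}

inductive St | a0 | a1 | A | b | B

def stp : St → Fin 2 × Bool → Option St
  | .a0, (0, true) => some .a0
  | .a0, (1, true) => some .b
  | .a0, (1, false) => some .B
  | .a1, (0, true) => some .a1
  | .a1, (1, true) => some .b
  | .A, (0, false) => some .A
  | .A, (1, true) => some .b
  | .b, (0, true) => some .a0
  | .b, (0, false) => some .A
  | .b, (1, true) => some .b
  | .B, (0, true) => some .a1
  | _, _ => none

def rn : St → List (Fin 2 × Bool) → Option St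
  | s, [] => some s
  | s, x :: l => (stp s x).bind (fun t => rn t l)

def gen (F : St → Bool) : ℕ → St → List (List (Fin 2 × Bool))
  | 0, s => if F s then [[]] else []
  | n + 1, .a0 => (gen F n .a0).map (lA :: ·) ++ ((gen F n .b).map (lB :: ·) ++
      (gen F n .B).map (lBi :: ·))
  | n + 1, .a1 => (gen F n .a1).map (lA :: ·) ++ (gen F n .b).map (lB :: ·)
  | n + 1, .A => (gen F n .A).map (lAi :: ·) ++ (gen F n .b).map (lB :: ·)
  | n + 1, .b => (gen F n .a0).map (lA :: ·) ++ ((gen F n .A).map (lAi :: ·) ++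
      (gen F n .b).map (lB :: ·))
  | n + 1, .B => (gen F n .a1).map (lA :: ·)

lemma letter_cases (x : Fin 2 × Bool) : x = lA ∨ x = lAi ∨ x = lB ∨ x = lBi := by
  revert x; decide

lemma mem_gen (F : St → Bool) (n : ℕ) : ∀ (s : St) (l : List (Fin 2 × Bool)),
    l ∈ gen F n s ↔ l.length = n ∧ ∃ t, rn s l = some t ∧ F t = true := by
  induction n with
  | zero =>
    intro s l
    cases l <;> simp [gen, rn]
  | succ n ih =>
    intro s l
    cases l with
    | nil => cases s <;> simp [gen]
    | cons x l =>
      rcases letter_cases x with rfl | rfl | rfl | rfl <;> cases s <;>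
        simp [gen, rn, ih, stp, lA, lAi, lB, lBi]

lemma gen_nodup (F : St → Bool) (n : ℕ) : ∀ (s : St), (gen F n s).Nodup := by
  induction n with
  | zero => intro s; simp only [gen]; split_ifs <;> simp
  | succ n ih =>
    have h : ∀ (x : Fin 2 × Bool) (s : St), ((gen F n s).map (x :: ·)).Nodup := fun x s =>
      (ih s).map (fun _ _ h => (List.cons.inj h).2)
    intro s
    cases s <;> simp [gen, List.nodup_append, h, lA, lAi, lB, lBi] <;> grind

lemma rn_append (s : St) (l m : List (Fin 2 × Bool)) :
    rn s (l ++ m) = (rn s l).bind (fun t => rn t m) := by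
  induction l generalizing s with
  | nil => rfl
  | cons x l ih =>
    simp only [List.cons_append, rn]
    cases stp s x <;> simp [ih]

lemma rn_sub {s t : St} {u l : List (Fin 2 × Bool)} (h : rn s l = some t) (hu : u <:+: l) :
    ∃ s', rn s' u ≠ none := by
  obtain ⟨p, q, rfl⟩ := hu
  rw [List.append_assoc, rn_append] at h
  cases hp : rn s p with
  | none => simp [hp] at h
  | some s' =>
    refine ⟨s', fun hn => ?_⟩
    simp [hp, rn_append, hn] at h

lemma rn_pow (k : ℕ) : ∀ s, (s = St.B ∨ s = St.a1) →
    rn s (List.replicate k lA ++ [lBi]) = none := by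
  induction k with
  | zero => rintro s (rfl | rfl) <;> simp [rn, stp, lBi]
  | succ k ih =>
    rintro s (rfl | rfl) <;> simp [List.replicate_succ, rn] <;>
      simp [stp, lA] <;> exact ih _ (Or.inr rfl)

lemma rn_bad (k : ℕ) (s : St) : rn s ([lBi] ++ List.replicate k lA ++ [lBi]) = none := by
  cases s <;> simp [rn] <;> simp [stp, lBi]
  exact rn_pow k _ (Or.inl rfl)

lemma rn_AB (s : St) : rn s [lAi, lBi] = none := by
  cases s <;> simp [rn, stp, lAi, lBi]

lemma rn_BA (s : St) : rn s [lBi, lAi] = none := by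
  cases s <;> simp [rn, stp, lAi, lBi]

lemma rn_inv (s : St) (x : Fin 2 × Bool) : rn s [x, (x.1, !x.2)] = none := by
  rcases letter_cases x with rfl | rfl | rfl | rfl <;> cases s <;>
    simp [rn, stp, lAi, lBi, lA, lB]

lemma reduced_of (l : List (Fin 2 × Bool))
    (h : ∀ x : Fin 2 × Bool, ¬ [x, (x.1, !x.2)] <:+: l) : FreeGroup.IsReduced l := by
  induction l with
  | nil => simp
  | cons x l ih =>
    have ih' := ih (fun y hy => h y (hy.trans (List.suffix_cons x l).isInfix))
    cases l with
    | nil => simp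
    | cons y l =>
      rw [FreeGroup.isReduced_cons_cons]
      refine ⟨fun e => ?_, ih'⟩
      by_contra hne
      apply h x
      refine ⟨[], l, ?_⟩
      obtain ⟨x1, x2⟩ := x
      obtain ⟨y1, y2⟩ := y
      simp at e hne ⊢
      subst e
      cases x2 <;> cases y2 <;> simp_all

lemma mk_mem (l : List (Fin 2 × Bool)) (h : rn .b l = some .b) :
    (FreeGroup.mk l).toWord = l ∧ FreeGroup.mk l ∈ Rinf := by
  have h2 : rn .b (l ++ l) = some .b := by simp [rn_append, h]
  have key : ∀ u, (∀ s, rn s u = none) → ¬ u <:+: (l ++ l) := fun u hu hi => by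
    obtain ⟨s, hs⟩ := rn_sub h2 hi
    exact hs (hu s)
  have hl : (FreeGroup.mk l).toWord = l := by
    rw [FreeGroup.toWord_mk]
    apply FreeGroup.IsReduced.reduce_eq
    apply reduced_of
    intro x hx
    exact key _ (fun s => rn_inv s x) (hx.trans (List.prefix_append l l).isInfix)
  refine ⟨hl, ?_, ?_, ?_, ?_⟩
  · intro x hx y hy
    rw [hl] at hx hy
    rintro rfl
    apply key _ (fun s => rn_inv s y)
    obtain ⟨q, hq⟩ := List.getLast?_eq_some_iff.1 hy
    obtain ⟨r, hr⟩ := List.head?_eq_some_iff.1 hx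
    refine ⟨q, r, ?_⟩
    conv_rhs =>
      congr
      · rw [hq]
      · rw [hr]
    simp
  · rintro ⟨_, hi⟩; rw [hl] at hi; exact key _ rn_AB hi
  · rintro ⟨_, hi⟩; rw [hl] at hi; exact key _ rn_BA hi
  · rintro k ⟨_, hi⟩; rw [hl] at hi; exact key _ (rn_bad k) hi

def PG (l : List (Fin 2 × Bool)) : Prop :=
  (∀ x : Fin 2 × Bool, ¬ [x, (x.1, !x.2)] <:+: l) ∧ ¬ [lAi, lBi] <:+: l ∧ ¬ [lBi, lAi] <:+: l ∧
    ∀ k : ℕ, ¬ ([lBi] ++ List.replicate k lA ++ [lBi]) <:+: l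

lemma PG.mono {l m : List (Fin 2 × Bool)} (h : PG l) (hm : m <:+: l) : PG m :=
  ⟨fun x hx => h.1 x (hx.trans hm), fun hx => h.2.1 (hx.trans hm),
    fun hx => h.2.2.1 (hx.trans hm), fun k hx => h.2.2.2 k (hx.trans hm)⟩

def ctx : St → ℕ → List (Fin 2 × Bool)
  | .a0, _ => [lA]
  | .a1, k => lBi :: List.replicate (k + 1) lA
  | .A, _ => [lAi]
  | .b, _ => [lB]
  | .B, _ => [lBi]

lemma rn_ex (l : List (Fin 2 × Bool)) : ∀ (s : St) (k : ℕ), PG (ctx s k ++ l) →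
    ∃ t, rn s l = some t := by
  induction l with
  | nil => intro s k _; exact ⟨s, rfl⟩
  | cons x l ih =>
    intro s k h
    have inv : ∀ y q, ctx s k = q ++ [y] → x ≠ (y.1, !y.2) := by
      rintro y q hq rfl
      exact h.1 y ⟨q, l, by simp [hq]⟩
    have suf : ∀ q y, ctx s k = q ++ [y] → PG ([x] ++ l) := by
      intro q y _
      exact h.mono ⟨ctx s k, [], by simp⟩
    have hx : PG ([x] ++ l) := h.mono ⟨ctx s k, [], by simp⟩
    cases s
    · rcases letter_cases x with rfl | rfl | rfl | rfl
      · exact ih .a0 0 hx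
      · exact absurd rfl (inv lA [] rfl)
      · exact ih .b 0 hx
      · exact ih .B 0 hx
    · rcases letter_cases x with rfl | rfl | rfl | rfl
      · refine ih .a1 (k + 1) ?_
        have : ctx .a1 (k + 1) ++ l = ctx .a1 k ++ lA :: l := by
          simp only [ctx]
          rw [List.replicate_succ' (n := k + 1)]
          simp
        rwa [this]
      · exact absurd rfl (inv lA (lBi :: List.replicate k lA) (by simp [ctx, List.replicate_succ']))
      · exact ih .b 0 hx
      · exact absurd ⟨[], l, by simp [ctx]⟩ (h.2.2.2 (k + 1))
    · rcases letter_cases x with rfl | rfl | rfl | rfl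
      · exact absurd rfl (inv lAi [] rfl)
      · exact ih .A 0 hx
      · exact ih .b 0 hx
      · exact absurd ⟨[], l, by simp [ctx]⟩ h.2.1
    · rcases letter_cases x with rfl | rfl | rfl | rfl
      · exact ih .a0 0 hx
      · exact ih .A 0 hx
      · exact ih .b 0 hx
      · exact absurd rfl (inv lB [] rfl)
    · rcases letter_cases x with rfl | rfl | rfl | rfl
      · refine ih .a1 0 ?_
        simpa [ctx] using h
      · exact absurd ⟨[], l, by simp [ctx]⟩ h.2.2.1
      · exact absurd rfl (inv lBi [] rfl)
      · exact absurd ⟨[], l, by simp [ctx]⟩ (h.2.2.2 0)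

lemma PG_of_mem {w : F2} (hw : w ∈ Rinf) : PG w.toWord := by
  obtain ⟨_, h1, h2, h3⟩ := hw
  have key : ∀ u, u <:+: w.toWord → CyclicSubword2 u w := fun u hu =>
    ⟨hu.length_le, hu.trans (List.prefix_append _ _).isInfix⟩
  refine ⟨?_, fun h => h1 (key _ h), fun h => h2 (key _ h), fun k h => h3 k (key _ h)⟩
  intro x hx
  have hr : FreeGroup.IsReduced w.toWord := FreeGroup.isReduced_toWord
  obtain ⟨p, q, h⟩ := hx
  rw [← h, FreeGroup.IsReduced] at hr
  simp [List.isChain_append] at hr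

lemma mem_upper {w : F2} (hw : w ∈ Rinf) :
    w.toWord ∈ gen (fun _ => true) w.norm .b ++ gen (fun _ => true) w.norm .a0 := by
  have h := PG_of_mem hw
  rw [List.mem_append, mem_gen, mem_gen]
  simp only [FreeGroup.norm, true_and, and_true]
  generalize w.toWord = l at h
  cases l with
  | nil => exact Or.inl ⟨.b, rfl⟩
  | cons x l =>
    rcases letter_cases x with rfl | rfl | rfl | rfl
    · exact Or.inl (rn_ex l .a0 0 h)
    · exact Or.inl (rn_ex l .A 0 h)
    · exact Or.inl (rn_ex l .b 0 h)
    · exact Or.inr (rn_ex l .B 0 h)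

def vv (x : ℝ) : St → ℝ
  | .a0 => x ^ 2 - x + 1
  | .a1 => x * (x - 1)
  | .A => x * (x - 1)
  | .b => x * (x - 1) ^ 2
  | .B => x - 1

lemma gen_upper (x : ℝ) (hr : x ^ 4 - 3 * x ^ 3 + x ^ 2 + x - 1 = 0) (hx : 2 ≤ x)
    (F : St → Bool) (n : ℕ) : ∀ s, ((gen F n s).length : ℝ) ≤ vv x s * x ^ n := by
  induction n with
  | zero =>
    intro s
    have h1 : ((gen F 0 s).length : ℝ) ≤ 1 := by
      simp only [gen]; split_ifs <;> simp
    refine h1.trans ?_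
    cases s <;> simp only [vv, pow_zero, mul_one] <;> nlinarith [mul_nonneg (sub_nonneg.2 hx) (sub_nonneg.2 hx), sq_nonneg (x-1), mul_nonneg (sub_nonneg.2 hx) (sq_nonneg (x-1))]
  | succ n ih =>
    intro s
    have e1 := ih .a0
    have e2 := ih .a1
    have e3 := ih .A
    have e4 := ih .b
    have e5 := ih .B
    simp only [vv] at e1 e2 e3 e4 e5
    cases s <;> simp only [gen, vv, List.length_append, List.length_map, Nat.cast_add, pow_succ]
    · linear_combination e1 + e4 + e5
    · linear_combination e2 + e4
    · linear_combination e3 + e4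
    · linear_combination e1 + e3 + e4 - x ^ n * hr
    · linear_combination e2

lemma gen_lower (x : ℝ) (hr : x ^ 4 - 3 * x ^ 3 + x ^ 2 + x - 1 = 0) (c : ℝ)
    (F : St → Bool) (n : ℕ) (h0 : ∀ s, c * vv x s ≤ ((gen F 2 s).length : ℝ)) :
    ∀ s, c * vv x s * x ^ n ≤ ((gen F (n + 2) s).length : ℝ) := by
  induction n with
  | zero => simpa using h0
  | succ n ih =>
    intro s
    have e1 := ih .a0
    have e2 := ih .a1
    have e3 := ih .A
    have e4 := ih .b
    have e5 := ih .B
    simp only [vv] at e1 e2 e3 e4 e5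
    rw [show n + 1 + 2 = (n + 2) + 1 from rfl]
    cases s <;> rw [gen] <;> simp only [vv, List.length_append, List.length_map, Nat.cast_add, pow_succ]
    · linear_combination e1 + e4 + e5
    · linear_combination e2 + e4
    · linear_combination e3 + e4
    · linear_combination e1 + e3 + e4 + c * x ^ n * hr
    · linear_combination e2

def isb : St → Bool
  | .b => true
  | _ => false

lemma root_ge (lam : ℝ)
    (hmax : ∀ x : ℝ, x ^ 4 - 3 * x ^ 3 + x ^ 2 + x - 1 = 0 → x ≤ lam) : 2 ≤ lam := by
  have hc : ContinuousOn (fun x : ℝ => x ^ 4 - 3 * x ^ 3 + x ^ 2 + x - 1) (Set.Icc 2 3) := by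
    fun_prop
  obtain ⟨x, hx, hx0⟩ := intermediate_value_Icc (by norm_num) hc
    (show (0 : ℝ) ∈ Set.Icc _ _ by constructor <;> norm_num)
  exact hx.1.trans (hmax x hx0)

lemma card_upper (n : ℕ) :
    Finite {w : F2 // w ∈ Rinf ∧ FreeGroup.norm w = n} ∧
    growth2 Rinf n ≤ (gen (fun _ => true) n .b).length + (gen (fun _ => true) n .a0).length := by
  set G := gen (fun _ => true) n .b ++ gen (fun _ => true) n .a0 with hG
  let f : {w : F2 // w ∈ Rinf ∧ FreeGroup.norm w = n} → {l // l ∈ G.toFinset} := fun w =>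
    ⟨w.1.toWord, by
      have := mem_upper w.2.1
      rw [w.2.2] at this
      simpa [hG] using this⟩
  have hf : Function.Injective f := fun u v h =>
    Subtype.ext (FreeGroup.toWord_injective (congrArg Subtype.val h))
  refine ⟨Finite.of_injective f hf, ?_⟩
  have := Nat.card_le_card_of_injective f hf
  have h2 := G.toFinset_card_le
  rw [Nat.card_eq_fintype_card (α := {l // l ∈ G.toFinset}), Fintype.card_coe] at this
  rw [hG, List.length_append] at h2
  exact this.trans h2

lemma card_lower (n : ℕ) : (gen isb n .b).length ≤ growth2 Rinf n := by
  have := (card_upper n).1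
  have hm : ∀ l ∈ gen isb n .b, l.length = n ∧ rn .b l = some .b := by
    intro l hl
    obtain ⟨h1, t, h2, h3⟩ := (mem_gen _ _ _ _).1 hl
    refine ⟨h1, ?_⟩
    cases t <;> simp_all [isb]
  let f : {l // l ∈ (gen isb n .b).toFinset} → {w : F2 // w ∈ Rinf ∧ FreeGroup.norm w = n} :=
    fun l => ⟨FreeGroup.mk l.1, by
      obtain ⟨h1, h2⟩ := hm l.1 (List.mem_toFinset.1 l.2)
      obtain ⟨h3, h4⟩ := mk_mem _ h2
      exact ⟨h4, by rw [FreeGroup.norm, h3, h1]⟩⟩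
  have hf : Function.Injective f := by
    intro u v h
    have h' : FreeGroup.mk u.1 = FreeGroup.mk v.1 := congrArg Subtype.val h
    have hu := (mk_mem _ (hm u.1 (List.mem_toFinset.1 u.2)).2).1
    have hv := (mk_mem _ (hm v.1 (List.mem_toFinset.1 v.2)).2).1
    apply Subtype.ext
    rw [← hu, ← hv, h']
  have := Nat.card_le_card_of_injective f hf
  rw [Nat.card_eq_fintype_card, Fintype.card_coe,
    List.toFinset_card_of_nodup (gen_nodup _ _ _)] at this
  exact this

theorem Rinf_growth (lam : ℝ)
    (hroot : lam ^ 4 - 3 * lam ^ 3 + lam ^ 2 + lam - 1 = 0)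
    (hmax : ∀ x : ℝ, x ^ 4 - 3 * x ^ 3 + x ^ 2 + x - 1 = 0 → x ≤ lam) :
    ∃ c > (0 : ℝ), ∃ C > (0 : ℝ), ∃ m : ℕ, ∀ n ≥ m,
      c * lam ^ n ≤ (growth2 Rinf n : ℝ) ∧ (growth2 Rinf n : ℝ) ≤ C * lam ^ n := by
  have h2 := root_ge lam hmax
  have hp : ∀ s, 0 < vv lam s := by
    have h1 : 0 < lam - 1 := by linarith
    have h0 : 0 < lam := by linarith
    intro s
    cases s <;> simp only [vv]
    · nlinarith
    all_goals positivity
  set T : ℝ := vv lam .a0 + vv lam .a1 + vv lam .A + vv lam .b + vv lam .B with hT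
  have hTs : ∀ s, vv lam s ≤ T := by
    have e1 := hp .a0
    have e2 := hp .a1
    have e3 := hp .A
    have e4 := hp .b
    have e5 := hp .B
    intro s
    cases s <;> linarith
  have hTp : 0 < T := (hp .b).trans_le (hTs .b)
  have hbase : ∀ s, 1 / T * vv lam s ≤ ((gen isb 2 s).length : ℝ) := by
    intro s
    have h1 : 1 / T * vv lam s ≤ 1 := by
      rw [one_div, inv_mul_le_iff₀ hTp, mul_one]; exact hTs s
    refine h1.trans ?_
    have : 1 ≤ (gen isb 2 s).length := by cases s <;> simp [gen, isb]
    exact_mod_cast this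
  have hlp : 0 < lam := by linarith
  refine ⟨1 / T * vv lam .b / lam ^ 2, by have := hp .b; positivity,
    vv lam .b + vv lam .a0, add_pos (hp _) (hp _), 2, ?_⟩
  intro n hn
  constructor
  · obtain ⟨k, rfl⟩ := Nat.exists_eq_add_of_le' hn
    have h3 := gen_lower lam hroot (1 / T) isb k hbase .b
    have h4 : ((gen isb (k + 2) .b).length : ℝ) ≤ (growth2 Rinf (k + 2) : ℝ) := by
      exact_mod_cast card_lower (k + 2)
    refine le_trans (le_of_eq ?_) (h3.trans h4)
    rw [pow_add]
    field_simp
  · have h3 := gen_upper lam hroot h2 (fun _ => true) n .b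
    have h4 := gen_upper lam hroot h2 (fun _ => true) n .a0
    have h5 : (growth2 Rinf n : ℝ) ≤ ((gen (fun _ => true) n .b).length : ℝ) +
        ((gen (fun _ => true) n .a0).length : ℝ) := by
      exact_mod_cast (card_upper n).2
    linarith
end

section
/- Let μ ≈ 2.53209 be the largest real root of the polynomial X³ − 3X² + 3. Then the number of cyclically reduced potentially positive elements of F₂ of reduced length n is O(μⁿ): there exist constants C > 0 and m such that 𝔤_n({w ∈ F₂ : w cyclically reduced and potentially positive}) ≤ C·μⁿ for all n ≥ m. -/
def Positive2 (w : F2) : Prop :=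
  w ∈ Submonoid.closure (Set.range (FreeGroup.of : Fin 2 → F2))

def PotPos2 (w : F2) : Prop := ∃ φ : F2 ≃* F2, Positive2 (φ w)

namespace PP

open FreeGroup hiding map_mul map_inv map_one norm_eq_zero

/-! ### Word metric on a free group -/

section metric
variable {α : Type} [DecidableEq α]

def lcp : List (α × Bool) → List (α × Bool) → ℕ
  | x :: xs, y :: ys => if x = y then lcp xs ys + 1 else 0
  | _, _ => 0

lemma lcp_nil_left (L : List (α × Bool)) : lcp [] L = 0 := by simp [lcp]
lemma lcp_nil_right (L : List (α × Bool)) : lcp L [] = 0 := by cases L <;> simp [lcp]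

lemma lcp_cons (x y : α × Bool) (xs ys : List (α × Bool)) :
    lcp (x :: xs) (y :: ys) = if x = y then lcp xs ys + 1 else 0 := by simp [lcp]

lemma lcp_comm (L M : List (α × Bool)) : lcp L M = lcp M L := by
  induction L generalizing M with
  | nil => rw [lcp_nil_left, lcp_nil_right]
  | cons x xs ih =>
    cases M with
    | nil => rw [lcp_nil_left, lcp_nil_right]
    | cons y ys => simp only [lcp_cons, ih ys, eq_comm]

lemma lcp_ultra (L M K : List (α × Bool)) : min (lcp L M) (lcp M K) ≤ lcp L K := by
  induction L generalizing M K with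
  | nil => simp [lcp_nil_left]
  | cons x xs ih =>
    cases M with
    | nil => simp [lcp_nil_right]
    | cons y ys =>
      cases K with
      | nil => simp [lcp_nil_right]
      | cons z zs =>
        have := ih ys zs
        simp only [lcp_cons]
        by_cases h1 : x = y
        · subst h1
          by_cases h2 : x = z <;> simp [h2]
          omega
        · simp [h1]

lemma lcp_le (L M : List (α × Bool)) : lcp L M ≤ L.length := by
  induction L generalizing M with
  | nil => simp [lcp_nil_left]
  | cons x xs ih =>
    cases M with
    | nil => simp [lcp_nil_right]
    | cons y ys =>
      have := ih ys
      simp only [lcp_cons]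
      split <;> simp <;> omega

lemma lcp_take (L M : List (α × Bool)) : L.take (lcp L M) = M.take (lcp L M) := by
  induction L generalizing M with
  | nil => simp [lcp_nil_left]
  | cons x xs ih =>
    cases M with
    | nil => simp [lcp_nil_right]
    | cons y ys =>
      have := ih ys
      simp only [lcp_cons]
      split <;> simp_all

lemma norm_mk_of_reduced {L : List (α × Bool)} (h : IsReduced L) : norm (mk L) = L.length := by
  rw [FreeGroup.norm, toWord_mk, h.reduce_eq]

lemma isReduced_invRev {L : List (α × Bool)} (h : IsReduced L) : IsReduced (invRev L) := by
  rw [isReduced_iff_reduce_eq] at *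
  rw [reduce_invRev, h]

lemma norm_lcp_list (L M : List (α × Bool)) (hL : IsReduced L) (hM : IsReduced M) :
    norm ((mk L)⁻¹ * mk M) + 2 * lcp L M = L.length + M.length := by
  induction L generalizing M with
  | nil =>
    have : (mk ([] : List (α × Bool))) = 1 := rfl
    simp [lcp_nil_left, this, norm_mk_of_reduced hM]
  | cons x xs ih =>
    cases M with
    | nil =>
      have : (mk ([] : List (α × Bool))) = 1 := rfl
      rw [this, mul_one, norm_inv_eq, norm_mk_of_reduced hL]
      simp [lcp_nil_right]
    | cons y ys =>
      rw [lcp_cons]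
      split
      case isTrue h =>
        subst h
        have h1 : mk (x :: xs) = mk [x] * mk xs := by simp [mul_mk]
        have h2 : mk (x :: ys) = mk [x] * mk ys := by simp [mul_mk]
        have := ih ys (List.IsChain.tail hL) (List.IsChain.tail hM)
        rw [h1, h2]
        simp only [List.length_cons]
        have e : (mk [x] * mk xs)⁻¹ * (mk [x] * mk ys) = (mk xs)⁻¹ * mk ys := by group
        rw [e]; omega
      case isFalse h =>
        rw [inv_mk, mul_mk, norm_mk_of_reduced]
        · simp
        · have h1 := isReduced_invRev hL
          rw [FreeGroup.IsReduced, List.isChain_append]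
          refine ⟨h1, hM, ?_⟩
          intro p hp q hq
          simp [invRev] at hp hq
          subst hp; subst hq
          intro e
          rcases x with ⟨x1, x2⟩
          rcases y with ⟨y1, y2⟩
          simp at *
          subst e
          cases x2 <;> cases y2 <;> simp_all

def gp (u v : FreeGroup α) : ℕ := lcp u.toWord v.toWord

lemma norm_gp (u v : FreeGroup α) : norm (u⁻¹ * v) + 2 * gp u v = norm u + norm v := by
  have := norm_lcp_list u.toWord v.toWord isReduced_toWord isReduced_toWord
  simpa [mk_toWord, FreeGroup.norm, gp] using this

lemma gp_comm (u v : FreeGroup α) : gp u v = gp v u := lcp_comm _ _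
lemma gp_ultra (u v w : FreeGroup α) : min (gp u v) (gp v w) ≤ gp u w := lcp_ultra _ _ _
lemma gp_le_left (u v : FreeGroup α) : gp u v ≤ norm u := lcp_le _ _
lemma gp_le_right (u v : FreeGroup α) : gp u v ≤ norm v := by rw [gp_comm]; exact gp_le_left _ _

/-- cancellation in the product `u * v` -/
def cc (u v : FreeGroup α) : ℕ := gp u⁻¹ v

lemma norm_cc (u v : FreeGroup α) : norm (u * v) + 2 * cc u v = norm u + norm v := by
  have := norm_gp u⁻¹ v
  simpa [cc, norm_inv_eq] using this

lemma exists_initial (u v : FreeGroup α) :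
    ∃ q : FreeGroup α, norm q = gp u v ∧ gp q u = gp u v ∧ gp q v = gp u v ∧
      norm (q⁻¹ * u) + gp u v = norm u := by
  have hr : IsReduced (u.toWord.take (gp u v)) :=
    List.IsChain.take isReduced_toWord _
  have hq : (mk (u.toWord.take (gp u v))).toWord = u.toWord.take (gp u v) := by
    rw [toWord_mk, hr.reduce_eq]
  have hle := lcp_le u.toWord v.toWord
  have key : ∀ (L : List (α × Bool)) (n : ℕ), n ≤ L.length → lcp (L.take n) L = n := by
    intro L
    induction L with
    | nil => intro n hn; simp at hn; simp [hn, lcp]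
    | cons x xs ih =>
      intro n hn
      cases n with
      | zero => simp [lcp]
      | succ n => simp [lcp_cons]; exact ih n (by simpa using hn)
  have k1 : gp (mk (u.toWord.take (gp u v))) u = gp u v := by
    rw [gp, hq]; exact key _ _ hle
  have n1 : norm (mk (u.toWord.take (gp u v))) = gp u v := by
    rw [FreeGroup.norm, hq]; simp; exact hle
  refine ⟨mk (u.toWord.take (gp u v)), n1, k1, ?_, ?_⟩
  · rw [gp, hq]
    have := lcp_take u.toWord v.toWord
    rw [show u.toWord.take (gp u v) = v.toWord.take (gp u v) from this]
    exact key _ _ (gp_le_right u v)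
  · have := norm_gp (mk (u.toWord.take (gp u v))) u
    omega

lemma cc_self_lt (x : FreeGroup α) (hx : x ≠ 1) : 2 * cc x x < norm x := by
  have h := norm_cc x x
  have hr : IsReduced x.toWord := isReduced_toWord
  have h1 := reduceCyclically.reduce_flatten_replicate_succ hr 1
  have h0 := reduceCyclically.conj_conjugator_reduceCyclically x.toWord
  have hw : (x * x).toWord = FreeGroup.reduce (List.replicate 2 x.toWord).flatten := by
    rw [toWord_mul]; simp [List.replicate]
  have hne : reduceCyclically x.toWord ≠ [] := by
    intro h2
    rw [h2] at h0
    have : mk x.toWord = 1 := by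
      rw [← h0, List.append_nil, ← mul_mk, ← inv_mk]
      simp only [mul_inv_cancel]
    rw [mk_toWord] at this
    exact hx this
  have hlen := List.length_pos_iff.mpr hne
  have : norm (x * x) = norm x + (reduceCyclically x.toWord).length := by
    rw [FreeGroup.norm, hw, FreeGroup.norm]
    have hl := congrArg List.length h0
    rw [h1]
    simp [List.replicate] at hl ⊢
    omega
  omega

lemma cc_inv (u v : FreeGroup α) : cc v⁻¹ u⁻¹ = cc u v := by
  simp [cc, gp_comm]

/-- The half-cancellation case: a conjugation followed by a Nielsen move is shorter. -/
lemma half_cancel (t r : FreeGroup α) (ht : t ≠ 1) (h1 : 2 * cc r t = norm t)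
    (h2 : 2 * cc t r = norm t) (h3 : norm t ≤ norm r) :
    ∃ q : FreeGroup α, norm (q⁻¹ * t * q) + norm (q⁻¹ * (r * t) * q) < norm t + norm r := by
  obtain ⟨q, q1, q2, q3, q4⟩ := exists_initial t⁻¹ r
  -- `t⁻¹ = q p⁻¹`, so `p = t q`
  have hc : gp t⁻¹ r = cc t r := rfl
  have hc' : gp r⁻¹ t = cc r t := rfl
  refine ⟨q, ?_⟩
  have ht0 : 0 < norm t := by
    rw [Nat.pos_iff_ne_zero, Ne, FreeGroup.norm_eq_zero]; exact ht
  have hp : norm (t * q) + gp t⁻¹ r = norm t := by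
    have : norm (t * q) = norm (q⁻¹ * t⁻¹) := by rw [← norm_inv_eq]; simp
    rw [this, q4, norm_inv_eq]
  have hA : norm (q⁻¹ * t * q) ≤ norm t := by
    have := norm_mul_le q⁻¹ (t * q)
    rw [norm_inv_eq] at this
    rw [mul_assoc]; omega
  -- y' = q⁻¹ r
  have hy' : norm (q⁻¹ * r) + norm q = norm r := by
    have := norm_gp q r
    omega
  have hB : q⁻¹ * (r * t) * q = (q⁻¹ * r) * (t * q) := by group
  have g1 : gp (q⁻¹ * r)⁻¹ r⁻¹ + norm q = norm r := by
    have := norm_gp (q⁻¹ * r)⁻¹ r⁻¹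
    rw [norm_inv_eq, norm_inv_eq] at this
    have e : (q⁻¹ * r)⁻¹⁻¹ * r⁻¹ = q⁻¹ := by group
    rw [e, norm_inv_eq] at this
    omega
  have g2 : gp t (t * q) + norm q = norm t := by
    have := norm_gp t (t * q)
    have e : t⁻¹ * (t * q) = q := by group
    rw [e] at this
    omega
  have u1 := gp_ultra r⁻¹ t (t * q)
  have u2 := gp_ultra (q⁻¹ * r)⁻¹ r⁻¹ (t * q)
  have := norm_gp (q⁻¹ * r)⁻¹ (t * q)
  rw [inv_inv, norm_inv_eq] at this
  rw [hB]
  omega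

end metric

/-- letters as group elements -/
def lt (s : Fin 2 × Bool) : F2 := mk [s]

lemma lt_inv (s : Fin 2 × Bool) : lt (s.1, !s.2) = (lt s)⁻¹ := by simp [lt, invRev]

/-- products of pairs without excessive cancellation -/
lemma prod_bounds (e : Fin 2 × Bool → F2)
    (H2 : ∀ s t r : Fin 2 × Bool, (s.1 = t.1 → s.2 = t.2) → (t.1 = r.1 → t.2 = r.2) →
      cc (e s) (e t) + cc (e t) (e r) < norm (e t))
    (L : List (Fin 2 × Bool)) : ∀ s t, IsReduced (s :: t :: L) →
      cc (e s) (((t :: L).map e).prod) = cc (e s) (e t) := by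
  induction L with
  | nil => intro s t _; simp
  | cons r L ih =>
    intro s t h
    have h' : IsReduced (t :: r :: L) := List.IsChain.tail h
    have st : s.1 = t.1 → s.2 = t.2 := by
      have := h; simp [FreeGroup.IsReduced] at this; exact this.1
    have tr : t.1 = r.1 → t.2 = r.2 := by
      have := h'; simp [FreeGroup.IsReduced] at this; exact this.1
    have i := ih t r h'
    have hh := H2 s t r st tr
    set Q := ((r :: L).map e).prod with hQ
    have hP : ((t :: r :: L).map e).prod = e t * Q := by simp [hQ]
    rw [hP]
    have n1 := norm_cc (e t) Q
    have n2 := norm_gp (e t) (e t * Q)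
    have ee : (e t)⁻¹ * (e t * Q) = Q := by group
    rw [ee] at n2
    have u1 := gp_ultra (e s)⁻¹ (e t) (e t * Q)
    have u2 := gp_ultra (e s)⁻¹ (e t * Q) (e t)
    have c1 := gp_comm (e t) (e t * Q)
    unfold cc at *
    omega

lemma prod_norm (e : Fin 2 × Bool → F2)
    (H1 : ∀ s t : Fin 2 × Bool, (s.1 = t.1 → s.2 = t.2) →
      2 * cc (e s) (e t) ≤ norm (e s) ∧ 2 * cc (e s) (e t) ≤ norm (e t))
    (H2 : ∀ s t r : Fin 2 × Bool, (s.1 = t.1 → s.2 = t.2) → (t.1 = r.1 → t.2 = r.2) →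
      cc (e s) (e t) + cc (e t) (e r) < norm (e t))
    (L : List (Fin 2 × Bool)) : ∀ s, IsReduced (s :: L) →
      norm (e s) ≤ norm (((s :: L).map e).prod) ∧
      ∀ t ∈ s :: L, norm (e t) ≤ norm (((s :: L).map e).prod) := by
  induction L with
  | nil => intro s _; simp
  | cons t L ih =>
    intro s h
    have h' : IsReduced (t :: L) := List.IsChain.tail h
    have st : s.1 = t.1 → s.2 = t.2 := by
      have := h; simp [FreeGroup.IsReduced] at this; exact this.1
    have b := prod_bounds e H2 L s t h
    obtain ⟨i1, i2⟩ := ih t h'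
    have h1 := H1 s t st
    have n := norm_cc (e s) ((t :: L).map e).prod
    have hP : ((s :: t :: L).map e).prod = e s * ((t :: L).map e).prod := by
      rw [List.map_cons, List.prod_cons]
    rw [hP]
    refine ⟨by omega, ?_⟩
    intro r hr
    rcases List.mem_cons.mp hr with rfl | hr
    · omega
    · have := i2 r hr
      omega

/-! ### Automorphisms -/

def A0 : F2 := of 0
def B0 : F2 := of 1

lemma hom_ext2 {G : Type*} [Group G] (f g : F2 →* G) (h0 : f A0 = g A0) (h1 : f B0 = g B0) :
    f = g := by
  ext i
  fin_cases i
  · exact h0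
  · exact h1

lemma aut_ext2 (f g : MulAut F2) (h0 : f A0 = g A0) (h1 : f B0 = g B0) : f = g := by
  have := hom_ext2 f.toMonoidHom g.toMonoidHom h0 h1
  ext x
  exact DFunLike.congr_fun this x

def hm (x y : F2) : F2 →* F2 := FreeGroup.lift ![x, y]

@[simp] lemma hm_A (x y : F2) : hm x y A0 = x := by simp [hm, A0]
@[simp] lemma hm_B (x y : F2) : hm x y B0 = y := by simp [hm, B0]

def mkAut (x y x' y' : F2) (h1 : hm x' y' x = A0) (h2 : hm x' y' y = B0)
    (h3 : hm x y x' = A0) (h4 : hm x y y' = B0) : MulAut F2 :=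
  MonoidHom.toMulEquiv (hm x y) (hm x' y')
    (by apply hom_ext2 <;> simp [h1, h2]) (by apply hom_ext2 <;> simp [h3, h4])

lemma mkAut_A (x y x' y' : F2) (h1 h2 h3 h4) : mkAut x y x' y' h1 h2 h3 h4 A0 = x := hm_A x y
lemma mkAut_B (x y x' y' : F2) (h1 h2 h3 h4) : mkAut x y x' y' h1 h2 h3 h4 B0 = y := hm_B x y

/-- `a ↦ ab` -/
def al : MulAut F2 := mkAut (A0 * B0) B0 (A0 * B0⁻¹) B0 (by simp) (by simp) (by simp) (by simp)
/-- `b ↦ ba` -/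
def be : MulAut F2 := mkAut A0 (B0 * A0) A0 (B0 * A0⁻¹) (by simp) (by simp) (by simp) (by simp)
def sw : MulAut F2 := mkAut B0 A0 B0 A0 (by simp) (by simp) (by simp) (by simp)
def fa : MulAut F2 := mkAut A0⁻¹ B0 A0⁻¹ B0 (by simp) (by simp) (by simp) (by simp)

@[simp] lemma al_A : al A0 = A0 * B0 := mkAut_A ..
@[simp] lemma al_B : al B0 = B0 := mkAut_B ..
@[simp] lemma be_A : be A0 = A0 := mkAut_A ..
@[simp] lemma be_B : be B0 = B0 * A0 := mkAut_B ..
@[simp] lemma sw_A : sw A0 = B0 := mkAut_A ..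
@[simp] lemma sw_B : sw B0 = A0 := mkAut_B ..
@[simp] lemma fa_A : fa A0 = A0⁻¹ := mkAut_A ..
@[simp] lemma fa_B : fa B0 = B0 := mkAut_B ..

lemma sw_sq : sw * sw = 1 := by apply aut_ext2 <;> simp
lemma fa_sq : fa * fa = 1 := by apply aut_ext2 <;> simp
lemma sw_inv : sw⁻¹ = sw := inv_eq_of_mul_eq_one_left sw_sq
lemma fa_inv : fa⁻¹ = fa := inv_eq_of_mul_eq_one_left fa_sq

/-- signed permutations -/
def Sym : Subgroup (MulAut F2) := Subgroup.closure {sw, fa}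

lemma sw_mem : sw ∈ Sym := Subgroup.subset_closure (by simp)
lemma fa_mem : fa ∈ Sym := Subgroup.subset_closure (by simp)

def fb : MulAut F2 := sw * fa * sw
lemma fb_mem : fb ∈ Sym := mul_mem (mul_mem sw_mem fa_mem) sw_mem
@[simp] lemma fb_A : fb A0 = A0 := by simp [fb]
@[simp] lemma fb_B : fb B0 = B0⁻¹ := by simp [fb]

lemma lt_0t : lt (0, true) = A0 := rfl
lemma lt_1t : lt (1, true) = B0 := rfl
lemma lt_0f : lt (0, false) = A0⁻¹ := rfl
lemma lt_1f : lt (1, false) = B0⁻¹ := rfl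

lemma exists_sym (s t : Fin 2 × Bool) (h : s.1 ≠ t.1) :
    ∃ σ ∈ Sym, σ A0 = lt s ∧ σ B0 = lt t := by
  have e1 : ∀ ε δ : Bool, ∃ σ ∈ Sym, σ A0 = lt (0, ε) ∧ σ B0 = lt (1, δ) := by
    intro ε δ
    cases ε <;> cases δ
    · exact ⟨fa * fb, mul_mem fa_mem fb_mem, by simp [lt_0f], by simp [lt_1f]⟩
    · exact ⟨fa, fa_mem, by simp [lt_0f], by simp [lt_1t]⟩
    · exact ⟨fb, fb_mem, by simp [lt_0t], by simp [lt_1f]⟩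
    · exact ⟨1, one_mem _, by simp [lt_0t], by simp [lt_1t]⟩
  obtain ⟨i, ε⟩ := s
  obtain ⟨j, δ⟩ := t
  fin_cases i <;> fin_cases j
  · simp at h
  · exact e1 ε δ
  · obtain ⟨σ, h1, h2, h3⟩ := e1 δ ε
    exact ⟨σ * sw, mul_mem h1 sw_mem, by simpa using h3, by simpa using h2⟩
  · simp at h

/-- the group generated by the Nielsen moves and inner automorphisms -/
def Nie : Subgroup (MulAut F2) := Subgroup.closure ({al, sw, fa} ∪ Set.range MulAut.conj)

lemma al_mem : al ∈ Nie := Subgroup.subset_closure (by simp)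
lemma conj_mem (g : F2) : MulAut.conj g ∈ Nie := Subgroup.subset_closure (by simp)
lemma sym_le : Sym ≤ Nie := by
  apply Subgroup.closure_mono
  intro x hx
  simp at hx ⊢
  tauto

lemma exists_trans (s t : Fin 2 × Bool) (h : s.1 ≠ t.1) :
    ∃ ν ∈ Nie, ν (lt s) = lt s * lt t ∧ ν (lt t) = lt t := by
  obtain ⟨σ, h1, h2, h3⟩ := exists_sym s t h
  refine ⟨σ * al * σ⁻¹, mul_mem (mul_mem (sym_le h1) al_mem) (inv_mem (sym_le h1)), ?_, ?_⟩
  · rw [← h2, ← h3]; simp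
  · rw [← h3]; simp

def tot (ψ : MulAut F2) : ℕ := norm (ψ A0) + norm (ψ B0)

lemma tot_eq (ψ : MulAut F2) (s t : Fin 2 × Bool) (h : s.1 ≠ t.1) :
    tot ψ = norm (ψ (lt s)) + norm (ψ (lt t)) := by
  obtain ⟨i, ε⟩ := s
  obtain ⟨j, δ⟩ := t
  fin_cases i <;> fin_cases j <;> cases ε <;> cases δ <;>
    simp [tot, lt_0t, lt_0f, lt_1t, lt_1f, norm_inv_eq] at h ⊢ <;> omega

lemma minimal_is_sym (ψ : MulAut F2) (hmin : ∀ ν ∈ Nie, tot ψ ≤ tot (ψ * ν)) : ψ ∈ Nie := by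
  set e : Fin 2 × Bool → F2 := fun s => ψ (lt s) with he
  have hinv : ∀ s : Fin 2 × Bool, e (s.1, !s.2) = (e s)⁻¹ := by
    intro s; simp only [he, lt_inv, map_inv]
  have hne : ∀ s, e s ≠ 1 := by
    intro s hs
    have h1 : lt s = 1 := by simpa [he] using hs
    have h2 := congrArg FreeGroup.norm h1
    rw [lt, norm_mk_of_reduced (by simp)] at h2
    simp at h2
  have hA : ∀ s t : Fin 2 × Bool, s.1 ≠ t.1 → 2 * cc (e s) (e t) ≤ norm (e t) := by
    intro s t h
    obtain ⟨ν, hν, h1, h2⟩ := exists_trans s t h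
    have h3 := hmin ν hν
    rw [tot_eq _ s t h, tot_eq _ s t h] at h3
    simp only [MulAut.mul_apply, h1, h2, map_mul] at h3
    have := norm_cc (e s) (e t)
    simp only [he] at *
    omega
  have hB : ∀ s t : Fin 2 × Bool, s.1 ≠ t.1 → 2 * cc (e s) (e t) ≤ norm (e s) := by
    intro s t h
    have := hA (t.1, !t.2) (s.1, !s.2) (by simpa using h.symm)
    rw [hinv, hinv, cc_inv, norm_inv_eq] at this
    exact this
  have hC : ∀ s, 2 * cc (e s) (e s) < norm (e s) := fun s => cc_self_lt _ (hne s)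
  have H1 : ∀ s t : Fin 2 × Bool, (s.1 = t.1 → s.2 = t.2) →
      2 * cc (e s) (e t) ≤ norm (e s) ∧ 2 * cc (e s) (e t) ≤ norm (e t) := by
    intro s t h
    by_cases h1 : s.1 = t.1
    · have : s = t := Prod.ext h1 (h h1)
      subst this
      have := hC s
      omega
    · exact ⟨hB s t h1, hA s t h1⟩
  have H2 : ∀ s t r : Fin 2 × Bool, (s.1 = t.1 → s.2 = t.2) → (t.1 = r.1 → t.2 = r.2) →
      cc (e s) (e t) + cc (e t) (e r) < norm (e t) := by
    intro s t r hst htr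
    have a1 := H1 s t hst
    have a2 := H1 t r htr
    by_contra hcon
    have b1 : 2 * cc (e s) (e t) = norm (e t) := by omega
    have b2 : 2 * cc (e t) (e r) = norm (e t) := by omega
    by_cases h1 : s.1 = t.1
    · have : s = t := Prod.ext h1 (hst h1)
      subst this
      have := hC s
      omega
    by_cases h2 : t.1 = r.1
    · have : t = r := Prod.ext h2 (htr h2)
      subst this
      have := hC t
      omega
    have h3 : s.1 = r.1 := by omega
    by_cases h4 : s.2 = r.2
    · have : s = r := Prod.ext h3 h4
      subst this
      obtain ⟨q, hq⟩ := half_cancel (e t) (e s) (hne t) b1 b2 (by omega)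
      obtain ⟨ν, hν, h5, h6⟩ := exists_trans s t h1
      obtain ⟨k, hk⟩ := ψ.surjective q⁻¹
      have h7 := hmin (MulAut.conj k * ν) (mul_mem (conj_mem _) hν)
      rw [tot_eq _ s t h1, tot_eq _ s t h1] at h7
      simp only [MulAut.mul_apply, h5, h6, MulAut.conj_apply, map_mul, map_inv,
        hk, inv_inv] at h7
      simp only [he, mul_assoc, mul_inv_cancel_left] at *
      omega
    · have : s = (r.1, !r.2) := Prod.ext h3 (Bool.eq_not.mpr h4)
      rw [this, hinv] at b1
      have u := gp_ultra (e t) (e r) (e t)⁻¹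
      have hh := hC t
      unfold cc at *
      rw [inv_inv] at b1
      rw [gp_comm (e r) (e t)] at b1
      rw [gp_comm (e r) (e t)⁻¹, gp_comm (e t) (e t)⁻¹] at u
      omega
  -- letters of norm one
  have key : ∀ i : Fin 2, ∃ L : List (Fin 2 × Bool), (L.map e).prod = of i ∧
      ∀ s ∈ L, norm (e s) ≤ 1 := by
    intro i
    refine ⟨(ψ⁻¹ (of i)).toWord, ?_, ?_⟩
    · have h0 : ∀ L : List (Fin 2 × Bool), (L.map e).prod = ψ (mk L) := by
        intro L
        induction L with
        | nil => simp [show (mk ([] : List (Fin 2 × Bool))) = 1 from rfl]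
        | cons x xs ih =>
          have : mk (x :: xs) = lt x * mk xs := by simp [lt, mul_mk]
          rw [this, map_mul, ← ih]; simp [he]
      rw [h0, mk_toWord]; simp
    · intro s hs
      have h0 : ∀ L : List (Fin 2 × Bool), (L.map e).prod = ψ (mk L) := by
        intro L
        induction L with
        | nil => simp [show (mk ([] : List (Fin 2 × Bool))) = 1 from rfl]
        | cons x xs ih =>
          have : mk (x :: xs) = lt x * mk xs := by simp [lt, mul_mk]
          rw [this, map_mul, ← ih]; simp [he]
      have hr : FreeGroup.IsReduced (ψ⁻¹ (of i)).toWord := isReduced_toWord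
      have hp := h0 (ψ⁻¹ (of i)).toWord
      rw [mk_toWord, MulAut.apply_inv_self] at hp
      cases hL : (ψ⁻¹ (of i)).toWord with
      | nil => rw [hL] at hs; simp at hs
      | cons x xs =>
        rw [hL] at hs hr hp
        have := (prod_norm e H1 H2 xs x hr).2 s hs
        rw [hp, norm_of] at this
        exact this
  have hnorm1 : ∀ j : Fin 2, norm (e (j, true)) = 1 := by
    intro j
    by_contra hj
    have hpos : ∀ s, 0 < norm (e s) := by
      intro s
      rw [Nat.pos_iff_ne_zero, Ne, FreeGroup.norm_eq_zero]; exact hne s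
    have hbad : ∀ δ, ¬ norm (e (j, δ)) ≤ 1 := by
      intro δ hδ
      have := hpos (j, true)
      cases δ
      · have h1 := hinv (j, true)
        simp only [Bool.not_true] at h1
        rw [h1, norm_inv_eq] at hδ
        omega
      · omega
    -- everything lies in the powers of the other generator
    have hz : ∀ i : Fin 2, (of i : F2) ∈ Subgroup.zpowers (e (1 - j, true)) := by
      intro i
      obtain ⟨L, hL, hs⟩ := key i
      rw [← hL]
      apply Subgroup.list_prod_mem
      intro x hx
      obtain ⟨⟨k, δ⟩, hk, rfl⟩ := List.mem_map.mp hx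
      have hkj : k ≠ j := by
        rintro rfl
        exact hbad δ (hs _ hk)
      have : k = 1 - j := by omega
      subst this
      cases δ
      · have h1 := hinv (1 - j, true)
        simp only [Bool.not_true] at h1
        rw [h1]
        exact inv_mem (Subgroup.mem_zpowers _)
      · exact Subgroup.mem_zpowers _
    obtain ⟨m, hm⟩ := Subgroup.mem_zpowers_iff.mp (hz 0)
    obtain ⟨n, hn⟩ := Subgroup.mem_zpowers_iff.mp (hz 1)
    have hcomm : (of 0 : F2) * of 1 = of 1 * of 0 := by
      rw [← hm, ← hn, ← zpow_add, ← zpow_add, add_comm]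
    have := congrArg toWord hcomm
    revert this
    decide
  have hlet : ∀ g : F2, norm g = 1 → ∃ s, g = lt s := by
    intro g hg
    obtain ⟨s, hs⟩ := List.length_eq_one_iff.mp hg
    exact ⟨s, by rw [lt, ← hs, mk_toWord]⟩
  obtain ⟨s, hs⟩ := hlet _ (hnorm1 0)
  obtain ⟨t, ht⟩ := hlet _ (hnorm1 1)
  have hst : s.1 ≠ t.1 := by
    intro h
    have hc : ∀ s t : Fin 2 × Bool, s.1 = t.1 → lt s = lt t ∨ lt s = (lt t)⁻¹ := by
      intro s t h
      by_cases h2 : s.2 = t.2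
      · left; rw [Prod.ext h h2]
      · right
        rw [← lt_inv]
        congr 1
        exact Prod.ext h (Bool.eq_not.mpr h2)
    rcases hc s t h with h | h
    · rw [← hs, ← ht] at h
      have h5 : lt (0, true) = lt (1, true) := ψ.injective h
      have := congrArg toWord h5
      revert this
      decide
    · rw [← hs, ← ht] at h
      have h5 : lt (0, true) = (lt (1, true))⁻¹ := ψ.injective (by rw [map_inv]; exact h)
      have := congrArg toWord h5
      revert this
      decide
  obtain ⟨σ, h1, h2, h3⟩ := exists_sym s t hst
  have : ψ = σ := by
    apply aut_ext2
    · rw [h2, ← hs]; rfl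
    · rw [h3, ← ht]; rfl
  rw [this]
  exact sym_le h1

theorem nie_top (φ : MulAut F2) : φ ∈ Nie := by
  have : ∃ n, ∃ ν ∈ Nie, tot (φ * ν) = n := ⟨_, 1, one_mem _, rfl⟩
  classical
  obtain ⟨ν, hν, h⟩ := Nat.find_spec this
  have h2 : φ * ν ∈ Nie := by
    apply minimal_is_sym
    intro ν' hν'
    rw [h]
    apply Nat.find_min' this
    exact ⟨ν * ν', mul_mem hν hν', by rw [mul_assoc]⟩
  simpa using mul_mem h2 (inv_mem hν)

/-! ### The orbit of the three-letter words -/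

lemma map_mem {s : Set F2} (f : F2 →* F2) (S : Submonoid F2) (h : ∀ x ∈ s, f x ∈ S) {x : F2}
    (hx : x ∈ Submonoid.closure s) : f x ∈ S := by
  have : Submonoid.closure s ≤ S.comap f := Submonoid.closure_le.mpr h
  exact this hx

lemma map_mem' {s : Set F2} (f : MulAut F2) (S : Submonoid F2) (h : ∀ x ∈ s, f x ∈ S) {x : F2}
    (hx : x ∈ Submonoid.closure s) : f x ∈ S := map_mem f.toMonoidHom S h hx

/-- words in `a, b, b⁻¹` ending in `a` -/
def U : Submonoid F2 := Submonoid.closure {x | ∃ n : ℤ, x = B0 ^ n * A0}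

lemma U_gen (n : ℤ) : B0 ^ n * A0 ∈ U := Submonoid.subset_closure ⟨n, rfl⟩

inductive R : F2 → Prop
  | baseU (w : F2) : w ∈ U → R w
  | baseB (n : ℤ) : R (B0 ^ n)
  | al (w : F2) : R w → R (al w)
  | be (w : F2) : R w → R (be w)
  | conj (g w : F2) : R w → R (g * w * g⁻¹)

def C (w : F2) : Prop := ∃ s ∈ Sym, R (s w)

lemma R.C {w : F2} (h : R w) : C w := ⟨1, one_mem _, h⟩

lemma C_sym {w : F2} (h : C w) {s : MulAut F2} (hs : s ∈ Sym) : C (s w) := by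
  obtain ⟨t, ht, h⟩ := h
  exact ⟨t * s⁻¹, mul_mem ht (inv_mem hs), by simpa using h⟩

lemma C_of_sym {w : F2} {s : MulAut F2} (hs : s ∈ Sym) (h : C (s w)) : C w := by
  have := C_sym h (inv_mem hs)
  simpa using this

lemma C_conj {w : F2} (g : F2) (h : C w) : C (g * w * g⁻¹) := by
  obtain ⟨t, ht, h⟩ := h
  refine ⟨t, ht, ?_⟩
  simp only [map_mul, map_inv]
  exact R.conj _ _ h

lemma C_conj' {f g : MulAut F2} (k w : F2) (h : f = MulAut.conj k * g) (hg : C (g w)) :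
    C (f w) := by
  rw [h]
  exact C_conj k hg

lemma al_inv_A : (MulEquiv.symm al) A0 = A0 * B0⁻¹ := by
  rw [MulEquiv.symm_apply_eq]; simp
lemma al_inv_B : (MulEquiv.symm al) B0 = B0 := by
  rw [MulEquiv.symm_apply_eq]; simp
lemma be_inv_A : (MulEquiv.symm be) A0 = A0 := by
  rw [MulEquiv.symm_apply_eq]; simp
lemma be_inv_B : (MulEquiv.symm be) B0 = B0 * A0⁻¹ := by
  rw [MulEquiv.symm_apply_eq]; simp
attribute [simp] al_inv_A al_inv_B be_inv_A be_inv_B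

def Gam : Set (MulAut F2) := {al, al⁻¹, be, be⁻¹}

def Nrm (s : MulAut F2) : Prop :=
  ∀ γ ∈ Gam, ∃ γ' ∈ Gam, ∃ k : F2, s * γ = MulAut.conj k * γ' * s

lemma nrm_sw : Nrm sw := by
  intro γ hγ
  rcases hγ with rfl | rfl | rfl | rfl
  · exact ⟨be, by simp [Gam], 1, by apply aut_ext2 <;> simp⟩
  · exact ⟨be⁻¹, by simp [Gam], 1, by apply aut_ext2 <;> simp⟩
  · exact ⟨al, by simp [Gam], 1, by apply aut_ext2 <;> simp⟩
  · exact ⟨al⁻¹, by simp [Gam], 1, by apply aut_ext2 <;> simp⟩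

lemma nrm_fa : Nrm fa := by
  intro γ hγ
  rcases hγ with rfl | rfl | rfl | rfl
  · exact ⟨al⁻¹, by simp [Gam], B0⁻¹, by apply aut_ext2 <;> simp [mul_assoc]⟩
  · exact ⟨al, by simp [Gam], B0, by apply aut_ext2 <;> simp [mul_assoc]⟩
  · exact ⟨be⁻¹, by simp [Gam], 1, by apply aut_ext2 <;> simp⟩
  · exact ⟨be, by simp [Gam], 1, by apply aut_ext2 <;> simp⟩

lemma nrm_mul {s t : MulAut F2} (hs : Nrm s) (ht : Nrm t) : Nrm (s * t) := by
  intro γ hγ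
  obtain ⟨γ', h1, k, h2⟩ := ht γ hγ
  obtain ⟨γ'', h3, k', h4⟩ := hs γ' h1
  refine ⟨γ'', h3, s k * k', ?_⟩
  have h5 : s * MulAut.conj k = MulAut.conj (s k) * s := by
    ext x; simp
  rw [mul_assoc, h2, ← mul_assoc, ← mul_assoc, h5, mul_assoc (MulAut.conj (s k)), h4]
  simp [mul_assoc]

lemma nrm_sym (s : MulAut F2) (hs : s ∈ Sym) : Nrm s ∧ Nrm s⁻¹ := by
  induction hs using Subgroup.closure_induction with
  | mem x hx =>
    rcases hx with rfl | rfl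
    · rw [sw_inv]; exact ⟨nrm_sw, nrm_sw⟩
    · rw [fa_inv]; exact ⟨nrm_fa, nrm_fa⟩
  | one =>
    have : Nrm 1 := fun γ hγ => ⟨γ, hγ, 1, by simp⟩
    simpa using this
  | mul x y _ _ hx hy =>
    rw [mul_inv_rev]
    exact ⟨nrm_mul hx.1 hy.1, nrm_mul hy.2 hx.2⟩
  | inv x _ hx => rw [inv_inv]; exact ⟨hx.2, hx.1⟩

lemma fb_U {w : F2} (h : w ∈ U) : fb w ∈ U := by
  refine map_mem' fb U ?_ h
  rintro x ⟨n, rfl⟩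
  have : fb (B0 ^ n * A0) = B0 ^ (-n) * A0 := by simp
  rw [this]
  exact U_gen _

lemma be_inv_eq : be⁻¹ = MulAut.conj A0 * (fb * be * fb) := by
  apply aut_ext2 <;> simp [mul_assoc]

lemma C_be_inv_of {w : F2} (h : R (fb w)) : C (be⁻¹ w) := by
  refine C_conj' A0 w be_inv_eq ?_
  exact C_sym (R.C (R.be _ h)) fb_mem

lemma R_gamma {w : F2} (h : R w) : C (al⁻¹ w) ∧ C (be⁻¹ w) := by
  induction h with
  | baseU w h =>
    refine ⟨?_, C_be_inv_of (R.baseU _ (fb_U h))⟩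
    have h1 : al⁻¹ = MulAut.conj B0 * (MulAut.conj B0⁻¹ * al⁻¹) := by simp
    refine C_conj' B0 w h1 (R.C (R.baseU _ ?_))
    refine map_mem' _ U ?_ h
    rintro x ⟨n, rfl⟩
    have : (MulAut.conj B0⁻¹ * al⁻¹) (B0 ^ n * A0) = B0 ^ (-1 + n) * A0 := by
      simp [mul_assoc, zpow_add]
    rw [this]
    exact U_gen _
  | baseB n =>
    refine ⟨?_, C_be_inv_of ?_⟩
    · have : al⁻¹ (B0 ^ n) = B0 ^ n := by simp
      rw [this]
      exact (R.baseB n).C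
    · have : fb (B0 ^ n) = B0 ^ (-n) := by simp
      rw [this]
      exact R.baseB _
  | al w h _ =>
    refine ⟨by simpa using h.C, ?_⟩
    obtain ⟨s, hs, h1, h2⟩ := exists_sym (1, true) (0, false) (by simp)
    have e : be⁻¹ * al = MulAut.conj A0 * (s * be) := by
      apply aut_ext2 <;> simp [h1, h2, lt_1t, lt_0f, mul_assoc]
    exact C_conj' A0 w e (C_sym (R.be _ h).C hs)
  | be w h _ =>
    refine ⟨?_, by simpa using h.C⟩
    obtain ⟨s, hs, h1, h2⟩ := exists_sym (1, false) (0, true) (by simp)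
    have e : al⁻¹ * be = MulAut.conj B0 * (s * al) := by
      apply aut_ext2 <;> simp [h1, h2, lt_1f, lt_0t, mul_assoc]
    exact C_conj' B0 w e (C_sym (R.al _ h).C hs)
  | conj g w h ih =>
    simp only [map_mul, map_inv]
    exact ⟨C_conj _ ih.1, C_conj _ ih.2⟩

lemma C_gamma {w : F2} (h : C w) {γ : MulAut F2} (hγ : γ ∈ Gam) : C (γ w) := by
  obtain ⟨s, hs, h⟩ := h
  obtain ⟨γ', h1, k, h2⟩ := (nrm_sym s hs).1 γ hγ
  apply C_of_sym hs
  have h3 : s (γ w) = (MulAut.conj k * γ' * s) w := by rw [← h2]; rfl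
  rw [h3]
  have h4 : C (γ' (s w)) := by
    rcases h1 with rfl | rfl | rfl | rfl
    · exact (R.al _ h).C
    · exact (R_gamma h).1
    · exact (R.be _ h).C
    · exact (R_gamma h).2
  exact C_conj k h4

lemma C_nie (ψ : MulAut F2) (h : ψ ∈ Nie) : ∀ w, C w → C (ψ w) ∧ C (ψ⁻¹ w) := by
  induction h using Subgroup.closure_induction with
  | mem x hx =>
    intro w hw
    rcases hx with (rfl | rfl | rfl) | ⟨g, rfl⟩
    · exact ⟨C_gamma hw (by simp [Gam]), C_gamma hw (by simp [Gam])⟩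
    · exact ⟨C_sym hw sw_mem, C_sym hw (inv_mem sw_mem)⟩
    · exact ⟨C_sym hw fa_mem, C_sym hw (inv_mem fa_mem)⟩
    · refine ⟨C_conj g hw, ?_⟩
      rw [← map_inv]
      exact C_conj g⁻¹ hw
  | one => intro w hw; simpa using hw
  | mul x y _ _ hx hy =>
    intro w hw
    rw [mul_inv_rev]
    exact ⟨(hx _ (hy _ hw).1).1, (hy _ (hx _ hw).2).2⟩
  | inv x _ hx => intro w hw; rw [inv_inv]; exact ⟨(hx _ hw).2, (hx _ hw).1⟩

lemma U_left {x : F2} (h : x ∈ U) : x = 1 ∨ ∀ n : ℤ, B0 ^ n * x ∈ U := by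
  induction h using Submonoid.closure_induction with
  | mem x hx =>
    obtain ⟨m, rfl⟩ := hx
    right
    intro n
    rw [← mul_assoc, ← zpow_add]
    exact U_gen _
  | one => left; rfl
  | mul x y hx hy h1 h2 =>
    rcases h1 with rfl | h1
    · simpa using h2
    · right
      intro n
      rw [← mul_assoc]
      exact mul_mem (h1 n) hy

lemma pos_form {w : F2} (h : Positive2 w) : ∃ x ∈ U, ∃ n : ℤ, w = x * B0 ^ n := by
  unfold Positive2 at h
  induction h using Submonoid.closure_induction_right with
  | one => exact ⟨1, one_mem _, 0, by simp⟩
  | mul_right x hx y hy ih =>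
    obtain ⟨u, hu, n, rfl⟩ := ih
    obtain ⟨i, rfl⟩ := hy
    fin_cases i
    · exact ⟨u * (B0 ^ n * A0), mul_mem hu (U_gen n), 0, by simp [mul_assoc, A0]⟩
    · refine ⟨u, hu, n + 1, ?_⟩
      rw [zpow_add, zpow_one, mul_assoc]
      rfl

lemma C_pos {w : F2} (h : Positive2 w) : C w := by
  obtain ⟨x, hx, n, rfl⟩ := pos_form h
  rcases U_left hx with rfl | h
  · rw [one_mul]; exact (R.baseB n).C
  · have := C_conj (B0 ^ (-n)) (R.baseU _ (h n)).C
    simpa using this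

theorem C_potPos {w : F2} (h : PotPos2 w) : C w := by
  obtain ⟨φ, h⟩ := h
  have := (C_nie φ (nie_top φ) _ (C_pos h)).2
  have e : (φ : MulAut F2)⁻¹ (φ w) = w := MulAut.inv_apply_self _ φ w
  rwa [e] at this

/-! ### Normal forms of the orbit -/

def Pos : Submonoid F2 := Submonoid.closure {A0, B0}
def Neg : Submonoid F2 := Submonoid.closure {A0⁻¹, B0⁻¹}
def Mm : Submonoid F2 := Submonoid.closure {A0, B0 * A0}
def G1 : Set F2 := {x | ∃ n : ℕ, x = B0⁻¹ * (A0⁻¹) ^ n}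
def G2 : Set F2 := {x | ∃ m ∈ Mm, x = B0⁻¹ * (A0 * m)}
def SG : Submonoid F2 := Submonoid.closure (G1 ∪ G2)

lemma posA : A0 ∈ Pos := Submonoid.subset_closure (by simp)
lemma posB : B0 ∈ Pos := Submonoid.subset_closure (by simp)
lemma negA : A0⁻¹ ∈ Neg := Submonoid.subset_closure (by simp)
lemma negB : B0⁻¹ ∈ Neg := Submonoid.subset_closure (by simp)
lemma MmA : A0 ∈ Mm := Submonoid.subset_closure (by simp)
lemma MmB : B0 * A0 ∈ Mm := Submonoid.subset_closure (by simp)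
lemma sg1 (n : ℕ) : B0⁻¹ * (A0⁻¹) ^ n ∈ SG := Submonoid.subset_closure (Or.inl ⟨n, rfl⟩)
lemma sg2 {m : F2} (h : m ∈ Mm) : B0⁻¹ * (A0 * m) ∈ SG :=
  Submonoid.subset_closure (Or.inr ⟨m, h, rfl⟩)
lemma sgB : B0⁻¹ ∈ SG := by simpa using sg1 0

def be' : MulAut F2 := MulAut.conj A0 * be
def al' : MulAut F2 := MulAut.conj B0 * al
@[simp] lemma be'_A : be' A0 = A0 := by simp [be']
@[simp] lemma be'_B : be' B0 = A0 * B0 := by simp [be', mul_assoc]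
@[simp] lemma al'_A : al' A0 = B0 * A0 := by simp [al', mul_assoc]
@[simp] lemma al'_B : al' B0 = B0 := by simp [al']

def s1 : MulAut F2 := fa * fb * sw
lemma s1_mem : s1 ∈ Sym := mul_mem (mul_mem fa_mem fb_mem) sw_mem
@[simp] lemma s1_A : s1 A0 = B0⁻¹ := by simp [s1]
@[simp] lemma s1_B : s1 B0 = A0⁻¹ := by simp [s1]

def ff : MulAut F2 := s1 * al'
@[simp] lemma ff_A : ff A0 = A0⁻¹ * B0⁻¹ := by simp [ff]
@[simp] lemma ff_B : ff B0 = A0⁻¹ := by simp [ff]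

lemma rot {P S : Submonoid F2} {Q : Set F2} (f : MulAut F2)
    (h : ∀ q ∈ Q, ∀ p ∈ P, f (q * p) ∈ S) {P0 : Set F2} (hP : P = Submonoid.closure P0) {x : F2}
    (hx : x ∈ Submonoid.closure (P0 ∪ Q)) :
    x ∈ P ∨ ∃ p ∈ P, ∃ x', x = p * x' ∧ ∀ p' ∈ P, f (x' * p') ∈ S := by
  induction hx using Submonoid.closure_induction_left with
  | one => left; exact one_mem _
  | mul_left y hy x _ ih =>
    rcases hy with hy | hy
    · have hy' : y ∈ P := by rw [hP]; exact Submonoid.subset_closure hy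
      rcases ih with h1 | ⟨p, hp, x', rfl, h2⟩
      · left; exact mul_mem hy' h1
      · right
        exact ⟨y * p, mul_mem hy' hp, x', by rw [mul_assoc], h2⟩
    · right
      refine ⟨1, one_mem _, y * x, by simp, ?_⟩
      intro p' hp'
      rcases ih with h1 | ⟨p, hp, x', rfl, h2⟩
      · rw [mul_assoc]; exact h y hy _ (mul_mem h1 hp')
      · have e : f (y * (p * x') * p') = f (y * p) * f (x' * p') := by simp [mul_assoc]
        rw [e]
        exact mul_mem (h y hy p hp) (h2 p' hp')

lemma rot' {P S : Submonoid F2} {Q : Set F2} (f : MulAut F2)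
    (h : ∀ q ∈ Q, ∀ p ∈ P, f (q * p) ∈ S) {P0 : Set F2} (hP : P = Submonoid.closure P0) {x : F2}
    (hx : x ∈ Submonoid.closure (P0 ∪ Q)) :
    x ∈ P ∨ ∃ k, f (k * x * k⁻¹) ∈ S := by
  rcases rot f h hP hx with h1 | ⟨p, hp, x', rfl, h2⟩
  · exact Or.inl h1
  · right
    refine ⟨p⁻¹, ?_⟩
    have := h2 p hp
    simpa [mul_assoc] using this

/-- elements equal to `1` or of the form `a m` -/
def AM (x : F2) : Prop := x = 1 ∨ ∃ m ∈ Mm, x = A0 * m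

lemma AM_mul {x y : F2} (hx : AM x) (hy : AM y) : AM (x * y) := by
  rcases hx with rfl | ⟨m, hm, rfl⟩
  · simpa using hy
  · right
    rcases hy with rfl | ⟨m', hm', rfl⟩
    · exact ⟨m, hm, by simp⟩
    · exact ⟨m * (A0 * m'), mul_mem hm (mul_mem MmA hm'), by simp [mul_assoc]⟩

lemma AM_SG {x : F2} (hx : AM x) : B0⁻¹ * x ∈ SG := by
  rcases hx with rfl | ⟨m, hm, rfl⟩
  · simpa using sgB
  · exact sg2 hm

def AMs : Submonoid F2 where
  carrier := {x | AM x}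
  mul_mem' := AM_mul
  one_mem' := Or.inl rfl

lemma AM_map {s : Set F2} (f : MulAut F2) (h : ∀ x ∈ s, AM (f x)) {x : F2}
    (hx : x ∈ Submonoid.closure s) : AM (f x) := map_mem' f AMs h hx

/-- `U` under `be` -/
def UP : Set F2 := {x | ∃ n : ℕ, x = B0 ^ n * A0}
def UQ : Set F2 := {x | ∃ n : ℕ, x = (B0⁻¹) ^ (n + 1) * A0}

lemma U_sub : U ≤ Submonoid.closure (UP ∪ UQ) := by
  refine Submonoid.closure_mono ?_
  rintro x ⟨n, rfl⟩
  obtain ⟨k, rfl | rfl⟩ := n.eq_nat_or_neg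
  · left; exact ⟨k, by simp⟩
  · cases k with
    | zero => left; exact ⟨0, by simp⟩
    | succ k => right; exact ⟨k, by rw [zpow_neg, inv_pow, zpow_natCast]⟩

lemma Mm_pow (n : ℕ) : (B0 * A0) ^ n ∈ Mm := pow_mem MmB n

lemma ab_pow (n : ℕ) : (A0 * B0) ^ n * A0 = A0 * (B0 * A0) ^ n := by
  induction n with
  | zero => simp
  | succ n ih => rw [pow_succ', mul_assoc, ih, pow_succ']; simp [mul_assoc]

lemma U_be {x : F2} (hx : x ∈ U) : x ∈ Pos ∨ ∃ k, be' (k * x * k⁻¹) ∈ SG := by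
  have key : ∀ q ∈ UQ, ∀ p ∈ Submonoid.closure UP, be' (q * p) ∈ SG := by
    rintro q ⟨n, rfl⟩ p hp
    have h1 : AM (be' p) := by
      refine AM_map be' ?_ hp
      rintro y ⟨n, rfl⟩
      right
      refine ⟨(B0 * A0) ^ n, Mm_pow n, ?_⟩
      simp [ab_pow]
    have e : be' ((B0⁻¹) ^ (n + 1) * A0 * p) = (B0⁻¹ * A0⁻¹) ^ n * (B0⁻¹ * be' p) := by
      simp [pow_succ, mul_assoc]
      rw [← inv_pow]; simp
    rw [e]
    refine mul_mem (pow_mem ?_ n) (AM_SG h1)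
    simpa using sg1 1
  rcases rot' (Q := UQ) (S := SG) be' key (P := Submonoid.closure UP) rfl (U_sub hx) with h | h
  · left
    refine (Submonoid.closure_le.mpr ?_ : Submonoid.closure UP ≤ Pos) h
    rintro y ⟨n, rfl⟩
    exact mul_mem (pow_mem posB n) posA
  · exact Or.inr h

lemma SG_be' {x : F2} (hx : x ∈ SG) : be' x ∈ SG := by
  refine map_mem' be' SG ?_ hx
  rintro y (⟨n, rfl⟩ | ⟨m, hm, rfl⟩)
  · have : be' (B0⁻¹ * (A0⁻¹) ^ n) = B0⁻¹ * (A0⁻¹) ^ (n + 1) := by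
      simp [pow_succ', mul_assoc]
    rw [this]
    exact sg1 _
  · have h1 : AM (be' m) := by
      refine AM_map be' ?_ hm
      rintro y (rfl | rfl)
      · right; exact ⟨1, one_mem _, by simp⟩
      · right; exact ⟨B0 * A0, MmB, by simp [mul_assoc]⟩
    have : be' (B0⁻¹ * (A0 * m)) = B0⁻¹ * be' m := by simp [mul_assoc]
    rw [this]
    exact AM_SG h1

lemma SG_ff {x : F2} (hx : x ∈ SG) : x ∈ Neg ∨ ∃ k, ff (k * x * k⁻¹) ∈ SG := by
  have key : ∀ q ∈ G2, ∀ p ∈ Submonoid.closure G1, ff (q * p) ∈ SG := by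
    rintro q ⟨m, hm, rfl⟩ p hp
    have h1 : AM (ff p) := by
      refine AM_map ff ?_ hp
      rintro y ⟨n, rfl⟩
      right
      exact ⟨(B0 * A0) ^ n, Mm_pow n, by simp; rw [← inv_pow]; simp⟩
    have h2 : (MulAut.conj B0⁻¹ * ff) m ∈ SG := by
      refine map_mem' _ SG ?_ hm
      rintro y (rfl | rfl)
      · simpa [mul_assoc] using sg1 1
      · simpa [mul_assoc, pow_succ] using sg1 2
    have e : ff (B0⁻¹ * (A0 * m) * p) = (MulAut.conj B0⁻¹ * ff) m * (B0⁻¹ * ff p) := by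
      simp [mul_assoc]
    rw [e]
    exact mul_mem h2 (AM_SG h1)
  rcases rot' (Q := G2) (S := SG) ff key (P := Submonoid.closure G1) rfl hx with h | h
  · left
    refine (Submonoid.closure_le.mpr ?_ : Submonoid.closure G1 ≤ Neg) h
    rintro y ⟨n, rfl⟩
    exact mul_mem negB (pow_mem negA n)
  · exact Or.inr h

def D0 (v : F2) : Prop := v ∈ Pos ∨ v ∈ Neg ∨ v ∈ U ∨ v ∈ SG ∨ s1 v ∈ SG
def D (w : F2) : Prop := ∃ k, D0 (k * w * k⁻¹)

lemma D_conj {w : F2} (g : F2) (h : D w) : D (g * w * g⁻¹) := by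
  obtain ⟨k, h⟩ := h
  refine ⟨k * g⁻¹, ?_⟩
  have : k * g⁻¹ * (g * w * g⁻¹) * (k * g⁻¹)⁻¹ = k * w * k⁻¹ := by simp [mul_assoc]
  rwa [this]

lemma D_conj_iff {w : F2} (g : F2) : D (g * w * g⁻¹) ↔ D w := by
  refine ⟨fun h => ?_, D_conj g⟩
  have := D_conj g⁻¹ h
  simpa [mul_assoc] using this

lemma D0.D {v : F2} (h : D0 v) : D v := ⟨1, by simpa using h⟩

lemma D_of_map {f : MulAut F2} (k x : F2) (h : D (f (k * x * k⁻¹))) : D (f x) := by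
  rw [map_mul, map_mul, map_inv, D_conj_iff] at h
  exact h

lemma D_be'_iff (v : F2) : D (be' v) ↔ D (be v) := D_conj_iff (w := be v) A0
lemma D_al'_iff (v : F2) : D (al' v) ↔ D (al v) := D_conj_iff (w := al v) B0

lemma s1_sq (v : F2) : s1 (s1 v) = v := by
  have : s1 * s1 = 1 := by apply aut_ext2 <;> simp
  exact DFunLike.congr_fun this v

lemma s1_al (v : F2) : s1 (al v) = be' (s1 v) := by
  have : s1 * al = be' * s1 := by apply aut_ext2 <;> simp
  exact DFunLike.congr_fun this v

lemma s1_be (v : F2) : s1 (be v) = al' (s1 v) := by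
  have : s1 * be = al' * s1 := by apply aut_ext2 <;> simp
  exact DFunLike.congr_fun this v

lemma s1_neg {v : F2} (h : s1 v ∈ Neg) : v ∈ Pos := by
  rw [← s1_sq v]
  refine map_mem' s1 Pos ?_ h
  rintro y (rfl | rfl)
  · simpa using posB
  · simpa using posA

lemma pos_al {v : F2} (h : v ∈ Pos) : al v ∈ Pos := by
  refine map_mem' al Pos ?_ h
  rintro y (rfl | rfl)
  · simpa using mul_mem posA posB
  · simpa using posB

lemma pos_be {v : F2} (h : v ∈ Pos) : be v ∈ Pos := by
  refine map_mem' be Pos ?_ h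
  rintro y (rfl | rfl)
  · simpa using posA
  · simpa using mul_mem posB posA

lemma neg_al {v : F2} (h : v ∈ Neg) : al v ∈ Neg := by
  refine map_mem' al Neg ?_ h
  rintro y (rfl | rfl)
  · simpa using mul_mem negB negA
  · simpa using negB

lemma neg_be {v : F2} (h : v ∈ Neg) : be v ∈ Neg := by
  refine map_mem' be Neg ?_ h
  rintro y (rfl | rfl)
  · simpa using negA
  · simpa using mul_mem negA negB

lemma D0_al {v : F2} (h : D0 v) : D (al v) := by
  rcases h with h | h | h | h | h
  · exact D0.D (Or.inl (pos_al h))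
  · exact D0.D (Or.inr (Or.inl (neg_al h)))
  · rw [← D_al'_iff]
    refine D0.D (Or.inr (Or.inr (Or.inl ?_)))
    refine map_mem' al' U ?_ h
    rintro y ⟨n, rfl⟩
    have : al' (B0 ^ n * A0) = B0 ^ (n + 1) * A0 := by simp [zpow_add, mul_assoc]
    rw [this]
    exact U_gen _
  · rcases SG_ff h with h1 | ⟨k, h1⟩
    · exact D0.D (Or.inr (Or.inl (neg_al h1)))
    · rw [← D_al'_iff]
      apply D_of_map k
      exact D0.D (Or.inr (Or.inr (Or.inr (Or.inr h1))))
  · refine D0.D (Or.inr (Or.inr (Or.inr (Or.inr ?_))))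
    rw [s1_al]
    exact SG_be' h

lemma D0_be {v : F2} (h : D0 v) : D (be v) := by
  rcases h with h | h | h | h | h
  · exact D0.D (Or.inl (pos_be h))
  · exact D0.D (Or.inr (Or.inl (neg_be h)))
  · rcases U_be h with h1 | ⟨k, h1⟩
    · exact D0.D (Or.inl (pos_be h1))
    · rw [← D_be'_iff]
      apply D_of_map k
      exact D0.D (Or.inr (Or.inr (Or.inr (Or.inl h1))))
  · rw [← D_be'_iff]
    exact D0.D (Or.inr (Or.inr (Or.inr (Or.inl (SG_be' h)))))
  · have e : be v = ff (s1 v) := by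
      rw [← s1_sq (be v), s1_be]; rfl
    rcases SG_ff h with h1 | ⟨k, h1⟩
    · exact D0.D (Or.inl (pos_be (s1_neg h1)))
    · rw [e]
      apply D_of_map k
      exact D0.D (Or.inr (Or.inr (Or.inr (Or.inl h1))))

theorem R_D {w : F2} (h : R w) : D w := by
  induction h with
  | baseU w h => exact D0.D (Or.inr (Or.inr (Or.inl h)))
  | baseB n =>
    obtain ⟨k, rfl | rfl⟩ := n.eq_nat_or_neg
    · exact D0.D (Or.inl (by simpa using pow_mem posB k))
    · exact D0.D (Or.inr (Or.inl (by simpa using pow_mem negB k)))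
  | al w _ ih =>
    obtain ⟨k, h⟩ := ih
    exact D_of_map k w (D0_al h)
  | be w _ ih =>
    obtain ⟨k, h⟩ := ih
    exact D_of_map k w (D0_be h)
  | conj g w _ ih => exact D_conj g ih

/-! ### Cyclic words -/

abbrev Let := Fin 2 × Bool

def rel0 (x y : Let) : Prop := x.1 = y.1 → x.2 = y.2

/-- cyclic chains -/
def CC (r : Let → Let → Prop) (L : List Let) : Prop :=
  List.IsChain r L ∧ ∀ a ∈ L.getLast?, ∀ b ∈ L.head?, r a b

lemma CC_mono {r r' : Let → Let → Prop} (h : ∀ x y, r x y → r' x y) {L : List Let} (hL : CC r L) :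
    CC r' L := ⟨hL.1.imp h, fun a ha b hb => h _ _ (hL.2 a ha b hb)⟩

lemma CC_cons {r : Let → Let → Prop} {x : Let} {L : List Let} :
    CC r (x :: L) ↔ List.IsChain r (x :: (L ++ [x])) := by
  unfold CC
  rw [← List.cons_append, List.isChain_append]
  simp

lemma CC_concat {r : Let → Let → Prop} {x : Let} {L : List Let} :
    CC r (L ++ [x]) ↔ List.IsChain r (x :: (L ++ [x])) := by
  unfold CC
  rw [List.isChain_cons, List.getLast?_concat]
  simp only [Option.mem_some_iff, forall_eq']
  tauto

lemma CC_rotate1 {r : Let → Let → Prop} {x : Let} {L : List Let} (h : CC r (x :: L)) :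
    CC r (L ++ [x]) := by
  rw [CC_concat, ← CC_cons]; exact h

lemma CC_rotate {r : Let → Let → Prop} (n : ℕ) : ∀ (L : List Let), CC r L → CC r (L.rotate n) := by
  induction n with
  | zero => intro L h; simpa using h
  | succ n ih =>
    intro L h
    cases L with
    | nil => simpa using h
    | cons x t =>
      rw [List.rotate_cons_succ]
      exact ih _ (CC_rotate1 h)

lemma CC_rotated {r : Let → Let → Prop} {L L' : List Let} (h : CC r L) (hr : L ~r L') :
    CC r L' := by
  obtain ⟨n, rfl⟩ := hr
  exact CC_rotate n L h

def bar (x : Let) : Let := (x.1, !x.2)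

lemma bar_bar (x : Let) : bar (bar x) = x := by simp [bar]

lemma not_rel0 {x y : Let} (h : ¬ rel0 x y) : y = bar x := by
  obtain ⟨i, a⟩ := x
  obtain ⟨j, b⟩ := y
  simp only [rel0, bar] at *
  cases a <;> cases b <;> simp_all

lemma lt_bar (x : Let) : lt (bar x) = (lt x)⁻¹ := lt_inv x

lemma mk_cons (x : Let) (L : List Let) : (mk (x :: L) : F2) = lt x * mk L := by
  simp [lt]

lemma mk_app (K L : List Let) : (mk (K ++ L) : F2) = mk K * mk L := by
  simp

/-- conjugates of cyclically reduced words -/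
def Cj (u : List Let) (v : F2) : Prop :=
  ∃ h u', u ~r u' ∧ List.IsChain rel0 (h ++ (u' ++ invRev h)) ∧ v = mk (h ++ (u' ++ invRev h))

lemma invRev_cons' (x : Let) (L : List Let) : invRev (x :: L) = invRev L ++ [bar x] := by
  simp [invRev, bar]

lemma Cj_step {u : List Let} (hu : CC rel0 u) (hne : u ≠ []) {v : F2} (h : Cj u v) (x : Let) :
    Cj u (lt x * v * (lt x)⁻¹) := by
  obtain ⟨h, u', hr, hc, rfl⟩ := h
  have hne' : u' ≠ [] := by
    rintro rfl
    exact hne (List.isRotated_nil_iff.mp hr)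
  have hu' : CC rel0 u' := CC_rotated hu hr
  cases h with
  | cons y t =>
    by_cases hxy : rel0 x y
    · refine ⟨x :: y :: t, u', hr, ?_, ?_⟩
      · rw [invRev_cons' x]
        have h1 : List.IsChain rel0 (x :: ((y :: t) ++ (u' ++ invRev (y :: t)))) := by
          rw [List.cons_append, List.isChain_cons_cons]
          exact ⟨hxy, hc⟩
        have h2 : x :: y :: t ++ (u' ++ (invRev (y :: t) ++ [bar x]))
          = (x :: ((y :: t) ++ (u' ++ invRev (y :: t)))) ++ [bar x] := by simp
        rw [h2, List.isChain_append]
        refine ⟨h1, by simp, ?_⟩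
        rw [invRev_cons']
        intro a ha b hb
        have e : x :: (y :: t ++ (u' ++ (invRev t ++ [bar y])))
          = (x :: (y :: t ++ (u' ++ invRev t))) ++ [bar y] := by simp
        rw [e, List.getLast?_concat] at ha
        simp at ha hb
        subst ha hb
        intro h3
        have := hxy h3.symm
        simp [bar, this]
      · rw [invRev_cons' x]
        simp only [mk_cons, mk_app, List.cons_append, List.append_nil, lt_bar, mul_assoc]
        simp [mul_assoc, lt_bar, mk_cons, ← one_eq_mk]
    · have hy := not_rel0 hxy
      subst hy
      refine ⟨t, u', hr, ?_, ?_⟩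
      · have e : bar x :: t ++ (u' ++ invRev (bar x :: t))
            = bar x :: ((t ++ (u' ++ invRev t)) ++ [x]) := by
          rw [invRev_cons']; simp [bar_bar]
        rw [e] at hc
        exact (List.IsChain.tail hc).left_of_append
      · rw [invRev_cons']
        simp only [mk_cons, mk_app, List.cons_append, bar_bar, lt_bar]
        simp [mul_assoc, ← one_eq_mk, mk_cons]
  | nil =>
    simp only [List.nil_append, invRev_empty, List.append_nil] at hc ⊢
    cases u' with
    | nil => exact absurd rfl hne'
    | cons y t =>
      by_cases hxy : rel0 x y
      · rcases List.eq_nil_or_concat (y :: t) with h0 | ⟨t', z, h0⟩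
        · simp at h0
        · rw [List.concat_eq_append] at h0
          by_cases hz : z = x
          · subst hz
            refine ⟨[], z :: t', ?_, ?_, ?_⟩
            · refine hr.trans ?_
              rw [h0]
              exact (List.IsRotated.symm ⟨1, by simp⟩)
            · rw [h0] at hu'
              simp
              have := CC_concat.mp hu'
              rw [← List.cons_append] at this
              exact this.left_of_append
            · rw [h0]
              simp only [mk_cons, mk_app, List.nil_append, invRev_empty, List.append_nil]
              simp [mul_assoc, ← one_eq_mk, mk_cons]
          · refine ⟨[x], y :: t, hr, ?_, ?_⟩
            · have h1 : List.IsChain rel0 (x :: y :: t) := by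
                rw [List.isChain_cons_cons]
                exact ⟨hxy, hc⟩
              have e : [x] ++ (y :: t ++ invRev [x]) = (x :: y :: t) ++ [bar x] := by
                simp [invRev, bar]
              rw [e, List.isChain_append]
              refine ⟨h1, by simp, ?_⟩
              intro a ha b hb
              rw [h0, ← List.cons_append, List.getLast?_concat] at ha
              simp at ha hb
              subst ha hb
              by_contra h3
              apply hz
              have := not_rel0 h3
              rw [← bar_bar x, this, bar_bar]
            · simp only [mk_cons, mk_app, List.cons_append, invRev_cons', invRev_empty,
                List.nil_append, lt_bar]
              simp [mul_assoc, ← one_eq_mk, mk_cons]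
      · have hy := not_rel0 hxy
        subst hy
        refine ⟨[], t ++ [bar x], hr.trans ⟨1, by simp⟩, ?_, ?_⟩
        · simpa using (CC_rotate1 hu').1
        · simp only [mk_cons, mk_app, List.nil_append, invRev_empty, List.append_nil, lt_bar]
          simp [mul_assoc, ← one_eq_mk, mk_cons]

lemma Cj_list {u : List Let} (hu : CC rel0 u) (hne : u ≠ []) (g : List Let) :
    Cj u (mk g * mk u * (mk g)⁻¹) := by
  induction g with
  | nil => exact ⟨[], u, List.IsRotated.refl _, by simpa using hu.1, by simp [← one_eq_mk]⟩
  | cons x g ih =>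
    have := Cj_step hu hne ih x
    rw [mk_cons]
    have e : lt x * mk g * mk u * (lt x * mk g)⁻¹
        = lt x * (mk g * mk u * (mk g)⁻¹) * (lt x)⁻¹ := by
      simp only [mul_inv_rev, mul_assoc]
    rw [e]
    exact this

lemma conj_rotated {u w : List Let} (hu : CC rel0 u) (hw : CC rel0 w) (g : F2)
    (h : (mk w : F2) = g * mk u * g⁻¹) : u ~r w := by
  by_cases hne : u = []
  · subst hne
    have h1 : (mk w : F2) = mk [] := by rw [h]; simp [← one_eq_mk]
    have h2 := reduce.sound h1
    rw [FreeGroup.IsReduced.reduce_eq (show FreeGroup.IsReduced w from hw.1)] at h2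
    rw [h2]; simp
  · obtain ⟨h', u', hr, hc, e⟩ := Cj_list hu hne g.toWord
    rw [mk_toWord, ← h] at e
    have h2 := reduce.sound e
    rw [FreeGroup.IsReduced.reduce_eq (show FreeGroup.IsReduced w from hw.1),
      FreeGroup.IsReduced.reduce_eq (show FreeGroup.IsReduced _ from hc)] at h2
    cases h' with
    | nil => rw [h2]; simpa using hr
    | cons y t =>
      exfalso
      have h3 := hw.2 (bar y) (by
        rw [h2, invRev_cons']
        have : y :: t ++ (u' ++ (invRev t ++ [bar y])) = (y :: t ++ (u' ++ invRev t)) ++ [bar y] := by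
          simp
        rw [this, List.getLast?_concat]; rfl) y (by rw [h2]; simp)
      have := h3 rfl
      simp [bar] at this

/-! ### The two languages -/

def la : Let := (0, true)
def lA : Let := (0, false)
def lb : Let := (1, true)
def lB : Let := (1, false)

def r1 (x y : Let) : Prop := rel0 x y ∧ x ≠ (0, false) ∧ y ≠ (0, false)
def r2 (x y : Let) : Prop := rel0 x y ∧ ¬ (x = (1, true) ∧ y = (1, true)) ∧
  ¬ (x = (1, true) ∧ y = (0, false)) ∧ ¬ (x = (0, false) ∧ y = (1, true))

instance : DecidableRel rel0 := fun x y => by unfold rel0; infer_instance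
instance : DecidableRel r1 := fun x y => by unfold r1; infer_instance
instance : DecidableRel r2 := fun x y => by unfold r2; infer_instance

lemma mk_la (L : List Let) : (mk (la :: L) : F2) = A0 * mk L := mk_cons _ _
lemma mk_lb (L : List Let) : (mk (lb :: L) : F2) = B0 * mk L := mk_cons _ _
lemma mk_lA (L : List Let) : (mk (lA :: L) : F2) = A0⁻¹ * mk L := mk_cons _ _
lemma mk_lB (L : List Let) : (mk (lB :: L) : F2) = B0⁻¹ * mk L := mk_cons _ _

lemma CC_of_head {r : Let → Let → Prop} {z : Let} {L : List Let} (h : List.IsChain r (L ++ [z]))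
    (hz : (L ++ [z]).head? = some z) : CC r L := by
  cases L with
  | nil => exact ⟨by simp, by simp⟩
  | cons x t =>
    have : x = z := by simpa using hz
    subst this
    exact CC_cons.mpr h

lemma Pos_list {x : F2} (h : x ∈ Pos) : ∃ L : List Let, mk L = x ∧ CC r1 L := by
  have : ∃ L : List Let, mk L = x ∧ ∀ l ∈ L, l.2 = true := by
    induction h using Submonoid.closure_induction_left with
    | one => exact ⟨[], rfl, by simp⟩
    | mul_left y hy x _ ih =>
      obtain ⟨L, rfl, h⟩ := ih
      rcases hy with rfl | rfl
      · exact ⟨la :: L, mk_la L, by simpa [la] using h⟩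
      · exact ⟨lb :: L, mk_lb L, by simpa [lb] using h⟩
  obtain ⟨L, h1, h2⟩ := this
  refine ⟨L, h1, ?_⟩
  have key : ∀ x y : Let, x.2 = true → y.2 = true → r1 x y := by decide
  constructor
  · apply List.Pairwise.isChain
    rw [List.pairwise_iff_forall_sublist]
    intro a b hab
    exact key a b (h2 a (hab.subset (by simp))) (h2 b (hab.subset (by simp)))
  · intro a ha b hb
    exact key a b (h2 a (List.mem_of_getLast? ha)) (h2 b (List.mem_of_head? hb))

lemma chain_rep {r : Let → Let → Prop} {x y : Let} (hxx : r x x) (hxy : r x y) (n : ℕ)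
    {K : List Let} (h : List.IsChain r K) (hK : K.head? = some y) :
    List.IsChain r (List.replicate n x ++ K) := by
  induction n with
  | zero => simpa using h
  | succ n ih =>
    rw [List.replicate_succ, List.cons_append, List.isChain_cons]
    refine ⟨?_, ih⟩
    cases n with
    | zero =>
      simp only [List.replicate_zero, List.nil_append, hK]
      intro z hz
      simp at hz
      rwa [← hz]
    | succ n => simpa [List.replicate_succ] using hxx

lemma chain_rep' {r : Let → Let → Prop} {w x y : Let} (hxx : r x x) (hxy : r x y) (hwx : r w x)
    (hwy : r w y) (n : ℕ) {K : List Let} (h : List.IsChain r K) (hK : K.head? = some y) :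
    List.IsChain r (w :: (List.replicate n x ++ K)) := by
  rw [List.isChain_cons]
  refine ⟨?_, chain_rep hxx hxy n h hK⟩
  cases n with
  | zero =>
    simp only [List.replicate_zero, List.nil_append, hK]
    intro z hz
    simp at hz
    rwa [← hz]
  | succ n => simpa [List.replicate_succ] using hwx

lemma mk_rep (x : Let) (n : ℕ) (L : List Let) :
    (mk (List.replicate n x ++ L) : F2) = lt x ^ n * mk L := by
  induction n with
  | zero => simp
  | succ n ih => rw [List.replicate_succ, List.cons_append, mk_cons, ih, pow_succ', mul_assoc]

lemma U_list {x : F2} (h : x ∈ U) : ∃ L : List Let, mk L = A0 * x * A0⁻¹ ∧ CC r1 L := by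
  have : ∃ L : List Let, mk L = A0 * x * A0⁻¹ ∧ List.IsChain r1 (L ++ [la]) ∧
      (L ++ [la]).head? = some la := by
    induction h using Submonoid.closure_induction_left with
    | one => exact ⟨[], by simp [← one_eq_mk], by simp, by simp⟩
    | mul_left y hy x _ ih =>
      obtain ⟨L, hL, h1, h2⟩ := ih
      obtain ⟨n, rfl⟩ := hy
      obtain ⟨k, rfl | rfl⟩ := n.eq_nat_or_neg
      · refine ⟨la :: (List.replicate k lb ++ L), ?_, ?_, by simp⟩
        · rw [mk_la, mk_rep, hL]
          simp [mul_assoc, lb, lt_1t]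
        · rw [List.cons_append, List.append_assoc]
          exact chain_rep' (y := la) (by decide) (by decide) (by decide) (by decide) k h1 h2
      · refine ⟨la :: (List.replicate k lB ++ L), ?_, ?_, by simp⟩
        · rw [mk_la, mk_rep, hL]
          simp [mul_assoc, lB, lt_1f]
        · rw [List.cons_append, List.append_assoc]
          exact chain_rep' (y := la) (by decide) (by decide) (by decide) (by decide) k h1 h2
  obtain ⟨L, h0, h1, h2⟩ := this
  exact ⟨L, h0, CC_of_head h1 h2⟩

lemma Mm_list {x : F2} (h : x ∈ Mm) : ∃ L : List Let, mk L = x ∧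
    List.IsChain r2 (la :: (L ++ [lB])) := by
  induction h using Submonoid.closure_induction_left with
  | one => exact ⟨[], rfl, by simp; decide⟩
  | mul_left y hy x _ ih =>
    obtain ⟨L, rfl, h⟩ := ih
    rcases hy with rfl | rfl
    · refine ⟨la :: L, mk_la L, ?_⟩
      rw [List.cons_append, List.isChain_cons_cons]
      exact ⟨by decide, h⟩
    · refine ⟨lb :: la :: L, by rw [mk_lb, mk_la, mul_assoc], ?_⟩
      rw [List.cons_append, List.isChain_cons_cons, List.cons_append, List.isChain_cons_cons]
      exact ⟨by decide, by decide, h⟩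

lemma SG_list {x : F2} (h : x ∈ SG) : ∃ L : List Let, mk L = x ∧ CC r2 L := by
  have : ∃ L : List Let, mk L = x ∧ List.IsChain r2 (L ++ [lB]) ∧
      (L ++ [lB]).head? = some lB := by
    induction h using Submonoid.closure_induction_left with
    | one => exact ⟨[], rfl, by simp, by simp⟩
    | mul_left y hy x _ ih =>
      obtain ⟨L, hL, h1, h2⟩ := ih
      rcases hy with ⟨n, rfl⟩ | ⟨m, hm, rfl⟩
      · refine ⟨lB :: (List.replicate n lA ++ L), ?_, ?_, by simp⟩
        · rw [mk_lB, mk_rep, hL]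
          simp [mul_assoc, lA, lt_0f]
        · rw [List.cons_append, List.append_assoc]
          exact chain_rep' (y := lB) (by decide) (by decide) (by decide) (by decide) n h1 h2
      · obtain ⟨M, rfl, h3⟩ := Mm_list hm
        refine ⟨lB :: la :: (M ++ L), ?_, ?_, by simp⟩
        · rw [mk_lB, mk_la, mk_app, hL]
          simp only [mul_assoc]
        · rw [List.cons_append, List.cons_append, List.isChain_cons_cons, List.append_assoc]
          refine ⟨by decide, ?_⟩
          obtain ⟨K, hK⟩ : ∃ K, L ++ [lB] = lB :: K := by
            cases hh : L ++ [lB] with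
            | nil => simp at hh
            | cons z K =>
              rw [hh] at h2
              simp at h2
              exact ⟨K, by rw [h2]⟩
          rw [hK] at h1 ⊢
          rw [← List.cons_append, List.isChain_split]
          exact ⟨h3, h1⟩
  obtain ⟨L, h0, h1, h2⟩ := this
  exact ⟨L, h0, CC_of_head h1 h2⟩

/-! ### Signed permutations on words -/

def Wd (s : MulAut F2) (π : Equiv.Perm Let) : Prop :=
  (∀ x, π (bar x) = bar (π x)) ∧ ∀ x, s (lt x) = lt (π x)

lemma Wd_list {s : MulAut F2} {π : Equiv.Perm Let} (h : Wd s π) (L : List Let) :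
    s (mk L) = mk (L.map π) := by
  induction L with
  | nil => simp [← one_eq_mk]
  | cons x L ih => rw [mk_cons, map_mul, ih, h.2, List.map_cons, mk_cons]

lemma Wd_sym {s : MulAut F2} (hs : s ∈ Sym) : ∃ π, Wd s π := by
  induction hs using Subgroup.closure_induction with
  | mem x hx =>
    rcases hx with rfl | rfl
    · refine ⟨Equiv.prodCongr (Equiv.swap 0 1) (Equiv.refl _), by decide, ?_⟩
      rintro ⟨i, b⟩
      fin_cases i <;> cases b <;> simp [lt_0t, lt_0f, lt_1t, lt_1f]
    · refine ⟨Equiv.swap (0, true) (0, false), by decide, ?_⟩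
      rintro ⟨i, b⟩
      have e1 : Equiv.swap ((0, true) : Let) (0, false) (1, true) = (1, true) := by decide
      have e2 : Equiv.swap ((0, true) : Let) (0, false) (1, false) = (1, false) := by decide
      fin_cases i <;> cases b <;> simp [lt_0t, lt_0f, lt_1t, lt_1f, e1, e2]
  | one => exact ⟨1, by simp, by simp⟩
  | mul x y _ _ hx hy =>
    obtain ⟨π, h1, h2⟩ := hx
    obtain ⟨ρ, h3, h4⟩ := hy
    exact ⟨π * ρ, by simp [h1, h3], by simp [h2, h4]⟩
  | inv x _ hx =>
    obtain ⟨π, h1, h2⟩ := hx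
    refine ⟨π⁻¹, ?_, ?_⟩
    · intro y
      rw [Equiv.Perm.inv_eq_iff_eq, h1]; simp
    · intro y
      apply x.injective
      rw [h2]; simp

lemma CC_map {s : MulAut F2} {π : Equiv.Perm Let} (h : Wd s π) {L : List Let} (hL : CC rel0 L) :
    CC rel0 (L.map π) := by
  have key : ∀ x y, rel0 x y → rel0 (π x) (π y) := by
    intro x y hxy
    by_contra h1
    have h2 := not_rel0 h1
    rw [← h.1] at h2
    have h3 := π.injective h2
    subst h3
    have := hxy rfl
    simp [bar] at this
  constructor
  · rw [List.isChain_map]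
    exact hL.1.imp key
  · intro a ha b hb
    simp only [List.getLast?_map, List.head?_map, Option.mem_def, Option.map_eq_some_iff] at ha hb
    obtain ⟨a', h1, rfl⟩ := ha
    obtain ⟨b', h2, rfl⟩ := hb
    exact key _ _ (hL.2 a' h1 b' h2)

lemma CC_toWord {w : F2} (h : CyclicallyReduced2 w) : CC rel0 w.toWord := by
  refine ⟨isReduced_toWord, ?_⟩
  intro a ha b hb
  by_contra h1
  exact h b hb a ha (not_rel0 h1)

lemma D0_list {v : F2} (h : D0 v) : ∃ s ∈ Sym, ∃ k : F2, ∃ L : List Let,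
    mk L = k * s v * k⁻¹ ∧ (CC r1 L ∨ CC r2 L) := by
  rcases h with h | h | h | h | h
  · obtain ⟨L, h1, h2⟩ := Pos_list h
    exact ⟨1, one_mem _, 1, L, by simpa using h1, Or.inl h2⟩
  · have h' : s1 v ∈ Pos := s1_neg (by rwa [s1_sq])
    obtain ⟨L, h1, h2⟩ := Pos_list h'
    exact ⟨s1, s1_mem, 1, L, by simpa using h1, Or.inl h2⟩
  · obtain ⟨L, h1, h2⟩ := U_list h
    exact ⟨1, one_mem _, A0, L, by simpa using h1, Or.inl h2⟩
  · obtain ⟨L, h1, h2⟩ := SG_list h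
    exact ⟨1, one_mem _, 1, L, by simpa using h1, Or.inr h2⟩
  · obtain ⟨L, h1, h2⟩ := SG_list h
    exact ⟨s1, s1_mem, 1, L, by simpa using h1, Or.inr h2⟩

theorem main_words {w : F2} (hc : CyclicallyReduced2 w) (hp : PotPos2 w) :
    ∃ π : Equiv.Perm Let, List.IsChain r1 (w.toWord.map π) ∨ List.IsChain r2 (w.toWord.map π) := by
  obtain ⟨s, hs, hR⟩ := C_potPos hp
  obtain ⟨k, hD⟩ := R_D hR
  obtain ⟨t, ht, k', L, h1, h2⟩ := D0_list hD
  obtain ⟨π, hπ⟩ := Wd_sym (mul_mem ht hs)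
  refine ⟨π, ?_⟩
  have h3 : CC rel0 (w.toWord.map π) := CC_map hπ (CC_toWord hc)
  have h4 : (mk (w.toWord.map π) : F2) = (k' * t k)⁻¹ * mk L * ((k' * t k)⁻¹)⁻¹ := by
    rw [← Wd_list hπ, mk_toWord, h1]
    simp only [map_mul, map_inv, MulAut.mul_apply]
    group
  have h5 : CC rel0 L := by
    rcases h2 with h2 | h2
    · exact CC_mono (fun _ _ h => h.1) h2
    · exact CC_mono (fun _ _ h => h.1) h2
  have h6 := conj_rotated h5 h3 _ h4
  rcases h2 with h2 | h2
  · exact Or.inl (CC_rotated h2 h6).1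
  · exact Or.inr (CC_rotated h2 h6).1

/-! ### Counting -/

def ch (r : Let → Let → Prop) [DecidableRel r] : ℕ → Let → Finset (List Let)
  | 0, _ => {[]}
  | n + 1, x => (Finset.univ.filter (r x)).biUnion fun y => (ch r n y).image (List.cons y)

lemma mem_ch (r : Let → Let → Prop) [DecidableRel r] (n : ℕ) : ∀ (x : Let) (L : List Let),
    List.IsChain r (x :: L) → L.length = n → L ∈ ch r n x := by
  induction n with
  | zero =>
    intro x L _ h
    have := List.length_eq_zero_iff.mp h
    simp [ch, this]
  | succ n ih =>
    intro x L h hn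
    cases L with
    | nil => simp at hn
    | cons y L =>
      rw [List.isChain_cons_cons] at h
      simp only [ch, Finset.mem_biUnion, Finset.mem_image]
      exact ⟨y, by simpa using h.1, L, ih y L h.2 (by simpa using hn), rfl⟩

lemma card_ch (r : Let → Let → Prop) [DecidableRel r] (c : Let → ℝ) (mu : ℝ)
    (hc : ∀ x, 1 ≤ c x) (hs : ∀ x, ∑ y ∈ Finset.univ.filter (r x), c y ≤ mu * c x)
    (hmu : 0 ≤ mu) (n : ℕ) : ∀ x, ((ch r n x).card : ℝ) ≤ c x * mu ^ n := by
  induction n with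
  | zero => intro x; simpa [ch] using hc x
  | succ n ih =>
    intro x
    have h1 : ((ch r (n + 1) x).card : ℝ) ≤ ∑ y ∈ Finset.univ.filter (r x), ((ch r n y).card : ℝ) := by
      rw [ch]
      norm_cast
      refine Finset.card_biUnion_le.trans (Finset.sum_le_sum fun y _ => Finset.card_image_le)
    calc ((ch r (n + 1) x).card : ℝ) ≤ ∑ y ∈ Finset.univ.filter (r x), ((ch r n y).card : ℝ) := h1
      _ ≤ ∑ y ∈ Finset.univ.filter (r x), c y * mu ^ n := Finset.sum_le_sum fun y _ => ih y
      _ = (∑ y ∈ Finset.univ.filter (r x), c y) * mu ^ n := by rw [Finset.sum_mul]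
      _ ≤ (mu * c x) * mu ^ n := mul_le_mul_of_nonneg_right (hs x) (by positivity)
      _ = c x * mu ^ (n + 1) := by ring

def al4 (r : Let → Let → Prop) [DecidableRel r] (n : ℕ) : Finset (List Let) :=
  Finset.univ.biUnion fun y => (ch r n y).image (List.cons y)

lemma mem_al4 (r : Let → Let → Prop) [DecidableRel r] (n : ℕ) (L : List Let)
    (h : List.IsChain r L) (hn : L.length = n + 1) : L ∈ al4 r n := by
  cases L with
  | nil => simp at hn
  | cons y L =>
    simp only [al4, Finset.mem_biUnion, Finset.mem_image]
    exact ⟨y, Finset.mem_univ _, L, mem_ch r n y L h (by simpa using hn), rfl⟩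

lemma card_al4 (r : Let → Let → Prop) [DecidableRel r] (c : Let → ℝ) (mu : ℝ)
    (hc : ∀ x, 1 ≤ c x) (hs : ∀ x, ∑ y ∈ Finset.univ.filter (r x), c y ≤ mu * c x)
    (hmu : 0 ≤ mu) (n : ℕ) : ((al4 r n).card : ℝ) ≤ (∑ x, c x) * mu ^ n := by
  have h1 : ((al4 r n).card : ℝ) ≤ ∑ y, ((ch r n y).card : ℝ) := by
    rw [al4]
    norm_cast
    exact Finset.card_biUnion_le.trans (Finset.sum_le_sum fun y _ => Finset.card_image_le)
  refine h1.trans ?_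
  rw [Finset.sum_mul]
  exact Finset.sum_le_sum fun y _ => card_ch r c mu hc hs hmu n y

lemma all_let {p : Let → Prop} (h1 : p (0, true)) (h2 : p (0, false)) (h3 : p (1, true))
    (h4 : p (1, false)) : ∀ x, p x := by
  rintro ⟨i, b⟩
  fin_cases i <;> cases b <;> assumption

lemma bound_r1 (mu : ℝ) (hmu : 5 / 2 ≤ mu) : ∃ K : ℝ, 0 < K ∧ ∀ n,
    ((al4 r1 n).card : ℝ) ≤ K * mu ^ n := by
  let c : Let → ℝ := fun x => if x = (0, true) then mu - 1 else 1
  have f1 : Finset.univ.filter (r1 (0, true)) = {(0, true), (1, true), (1, false)} := by decide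
  have f2 : Finset.univ.filter (r1 (0, false)) = ∅ := by decide
  have f3 : Finset.univ.filter (r1 (1, true)) = {(0, true), (1, true)} := by decide
  have f4 : Finset.univ.filter (r1 (1, false)) = {(0, true), (1, false)} := by decide
  have hc : ∀ x, 1 ≤ c x := by
    intro x
    simp only [c]
    split_ifs <;> linarith
  refine ⟨∑ x, c x, Finset.sum_pos (fun x _ => by linarith [hc x]) ⟨(0, true), by simp⟩,
    card_al4 r1 c mu hc ?_ (by linarith)⟩
  apply all_let
  · rw [f1]; simp [c]; nlinarith
  · rw [f2]; simp [c]; linarith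
  · rw [f3]; simp [c]
  · rw [f4]; simp [c]

lemma bound_r2 (mu : ℝ) (hmu : 5 / 2 ≤ mu) (hroot : mu ^ 3 - 3 * mu ^ 2 + 3 = 0) :
    ∃ K : ℝ, 0 < K ∧ ∀ n, ((al4 r2 n).card : ℝ) ≤ K * mu ^ n := by
  let c : Let → ℝ := fun x => if x = (0, true) then 2 * (mu ^ 2 - 2 * mu) else
    if x = (0, false) then 2 else if x = (1, true) then 2 * (mu - 2) else 2 * (mu - 1)
  have f1 : Finset.univ.filter (r2 (0, true)) = {(0, true), (1, true), (1, false)} := by decide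
  have f2 : Finset.univ.filter (r2 (0, false)) = {(0, false), (1, false)} := by decide
  have f3 : Finset.univ.filter (r2 (1, true)) = {(0, true)} := by decide
  have f4 : Finset.univ.filter (r2 (1, false)) = {(0, true), (0, false), (1, false)} := by decide
  have hc : ∀ x, 1 ≤ c x := by
    intro x
    simp only [c]
    split_ifs <;> nlinarith
  refine ⟨∑ x, c x, Finset.sum_pos (fun x _ => by linarith [hc x]) ⟨(0, true), by simp⟩,
    card_al4 r2 c mu hc ?_ (by linarith)⟩
  apply all_let
  · rw [f1]; simp [c]; nlinarith
  · rw [f2]; simp [c]; linarith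
  · rw [f3]; simp [c]; nlinarith
  · rw [f4]; simp [c]; nlinarith

lemma mu_ge (mu : ℝ) (hmax : ∀ x : ℝ, x ^ 3 - 3 * x ^ 2 + 3 = 0 → x ≤ mu) : 5 / 2 ≤ mu := by
  have hcont : ContinuousOn (fun x : ℝ => x ^ 3 - 3 * x ^ 2 + 3) (Set.Icc (5 / 2) (13 / 5)) := by
    fun_prop
  have := intermediate_value_Icc (by norm_num : (5 / 2 : ℝ) ≤ 13 / 5) hcont
  obtain ⟨x, hx, h0⟩ := this (show (0 : ℝ) ∈ _ by constructor <;> norm_num)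
  exact hx.1.trans (hmax x h0)

def allWords (n : ℕ) : Finset (List Let) :=
  (Finset.univ : Finset (Equiv.Perm Let)).biUnion fun π =>
    (al4 r1 n ∪ al4 r2 n).image (List.map π.symm)

lemma card_allWords (n : ℕ) : (allWords n).card ≤
    Fintype.card (Equiv.Perm Let) * ((al4 r1 n).card + (al4 r2 n).card) := by
  unfold allWords
  refine Finset.card_biUnion_le_card_mul _ _ _ fun π _ => ?_
  exact Finset.card_image_le.trans (Finset.card_union_le _ _)

lemma growth_le (n : ℕ) :
    growth2 {w | CyclicallyReduced2 w ∧ PotPos2 w} (n + 1) ≤ (allWords n).card := by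
  unfold growth2
  have hmem : ∀ w : {w : F2 // w ∈ {w | CyclicallyReduced2 w ∧ PotPos2 w} ∧
      FreeGroup.norm w = n + 1}, w.1.toWord ∈ allWords n := by
    rintro ⟨w, ⟨h1, h2⟩, h3⟩
    have h3' : w.toWord.length = n + 1 := h3
    obtain ⟨π, h⟩ := main_words h1 h2
    simp only [allWords, Finset.mem_biUnion, Finset.mem_image]
    refine ⟨π, Finset.mem_univ _, w.toWord.map π, ?_, by simp⟩
    rw [Finset.mem_union]
    rcases h with h | h
    · exact Or.inl (mem_al4 _ _ _ h (by simpa using h3'))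
    · exact Or.inr (mem_al4 _ _ _ h (by simpa using h3'))
  have := Nat.card_le_card_of_injective
    (fun w => (⟨w.1.toWord, hmem w⟩ : {L // L ∈ allWords n})) (by
      intro x y hxy
      simp only [Subtype.mk.injEq] at hxy
      exact Subtype.ext (toWord_injective hxy))
  simpa using this

end PP

theorem pp_growth_upper_bound (mu : ℝ)
    (hroot : mu ^ 3 - 3 * mu ^ 2 + 3 = 0)
    (hmax : ∀ x : ℝ, x ^ 3 - 3 * x ^ 2 + 3 = 0 → x ≤ mu) :
    ∃ C > (0 : ℝ), ∃ m : ℕ, ∀ n ≥ m,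
      (growth2 {w | CyclicallyReduced2 w ∧ PotPos2 w} n : ℝ) ≤ C * mu ^ n := by
  have hmu := PP.mu_ge mu hmax
  obtain ⟨K1, hK1, h1⟩ := PP.bound_r1 mu hmu
  obtain ⟨K2, hK2, h2⟩ := PP.bound_r2 mu hmu hroot
  have hN : (0 : ℝ) < Fintype.card (Equiv.Perm PP.Let) := by exact_mod_cast Fintype.card_pos
  refine ⟨Fintype.card (Equiv.Perm PP.Let) * (K1 + K2), by positivity, 1, ?_⟩
  intro n hn
  obtain ⟨k, rfl⟩ : ∃ k, n = k + 1 := ⟨n - 1, by omega⟩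
  have h3 : (growth2 {w | CyclicallyReduced2 w ∧ PotPos2 w} (k + 1) : ℝ) ≤
      Fintype.card (Equiv.Perm PP.Let) *
        (((PP.al4 PP.r1 k).card : ℝ) + ((PP.al4 PP.r2 k).card : ℝ)) := by
    exact_mod_cast (PP.growth_le k).trans (PP.card_allWords k)
  have hp : mu ^ k ≤ mu ^ (k + 1) := pow_le_pow_right₀ (by linarith) (by omega)
  calc _ ≤ _ := h3
    _ ≤ Fintype.card (Equiv.Perm PP.Let) * (K1 * mu ^ k + K2 * mu ^ k) := by
      gcongr
      · exact h1 k
      · exact h2 k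
    _ = Fintype.card (Equiv.Perm PP.Let) * (K1 + K2) * mu ^ k := by ring
    _ ≤ _ := by gcongr
end
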